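/- arXiv:1607.04873 — 7 statements merged into one kernel-verified Lean document; each statement's English description precedes it below -/
import Mathlib

section
/- Let K be a field and fix an integer n ≥ 2. There exists a constant C₁ > 0 (depending on n but not on d) such that for every integer d ≥ 1, the minimal size N*(n,d) of a uniform determinantal representation of the generic polynomial of degree d in n variables satisfies N*(n,d) ≥ C₁ · d^(n/2) (with d^(n/2) interpreted as the real number (d:ℝ)^(n/2)). -/
open MvPolynomial

/-- Exponent vectors in `n` variables of total degree at most `d`. -/
def ExpLE (n d : ℕ) : Type := {α : Fin n →₀ ℕ // (α.sum fun _ e => e) ≤ d}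

noncomputable instance (n d : ℕ) : Fintype (ExpLE n d) := by
  have key : ∀ α : ExpLE n d, ∀ i, α.1 i < d + 1 := by
    intro α i
    refine Nat.lt_succ_of_le (le_trans ?_ α.2)
    by_cases h : α.1 i = 0
    · simp [h]
    · rw [Finsupp.sum]
      exact Finset.single_le_sum (f := fun j => α.1 j) (fun _ _ => Nat.zero_le _)
        (Finsupp.mem_support_iff.mpr h)
  exact Fintype.ofInjective (fun α : ExpLE n d => fun i => (⟨α.1 i, key α i⟩ : Fin (d+1)))
    (fun α β h => Subtype.ext (Finsupp.ext fun i => congrArg Fin.val (congrFun h i)))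

instance (n d : ℕ) : DecidableEq (ExpLE n d) := by
  unfold ExpLE; infer_instance

/-- The ring `R = K[x₁,…,xₙ,(c_α)_{|α|≤d}]`. -/
abbrev URing (K : Type*) [Field K] (n d : ℕ) := MvPolynomial (Fin n ⊕ ExpLE n d) K

/-- The generic polynomial `p_{n,d} = Σ_{|α|≤d} c_α x^α`. -/
noncomputable def genPoly (K : Type*) [Field K] (n d : ℕ) : URing K n d :=
  ∑ α : ExpLE n d, X (Sum.inr α) * ∏ i : Fin n, X (Sum.inl i) ^ (α.1 i)

/-- The monomials `1, xᵢ, c_α, c_α xᵢ`. -/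
def allowedMonomials (K : Type*) [Field K] (n d : ℕ) : Set (URing K n d) :=
  {1} ∪ (Set.range fun i : Fin n => (X (Sum.inl i) : URing K n d))
    ∪ (Set.range fun α : ExpLE n d => (X (Sum.inr α) : URing K n d))
    ∪ (Set.range fun p : ExpLE n d × Fin n =>
        (X (Sum.inr p.1) * X (Sum.inl p.2) : URing K n d))

/-- A uniform determinantal representation of `p_{n,d}` of size `N`. -/
def IsUDR (K : Type*) [Field K] (n d N : ℕ)
    (M : Matrix (Fin N) (Fin N) (URing K n d)) : Prop :=
  (∀ i j, M i j ∈ Submodule.span K (allowedMonomials K n d)) ∧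
    M.det = genPoly K n d

/-- `N*(n,d)`: the minimal size of a uniform determinantal representation. -/
noncomputable def Nstar (K : Type*) [Field K] (n d : ℕ) : ℕ :=
  sInf {N : ℕ | ∃ M : Matrix (Fin N) (Fin N) (URing K n d), IsUDR K n d N M}

/-- Setting all the `c_α` to zero: `M ↦ M₀` entrywise. -/
noncomputable def killC (K : Type*) [Field K] (n d : ℕ) :
    URing K n d →ₐ[K] MvPolynomial (Fin n) K :=
  aeval (Sum.elim X fun _ => 0)

/-- A subspace `V ⊆ K[x₁,…,xₙ]` is connected to 1. -/
def ConnectedToOne (K : Type*) [Field K] (n : ℕ)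
    (V : Submodule K (MvPolynomial (Fin n) K)) : Prop :=
  V ≠ ⊥ ∧ ∀ e : ℕ,
    V ⊓ restrictTotalDegree (Fin n) K (e + 1) ≤
      restrictTotalDegree (Fin n) K 1 * (V ⊓ restrictTotalDegree (Fin n) K e)

open Matrix in
/-- `f` is represented over `S` if `f = u A⁻¹ v` for some square matrix `A` of determinant one
and vectors `u`, `v`, all with entries in `S`; here `w` is the vector `A⁻¹ v`. -/
def IsBilinearRep {R : Type*} [CommRing R] (S : Set R) (f : R) : Prop :=
  ∃ (ι : Type) (_ : Fintype ι) (_ : DecidableEq ι) (A : Matrix ι ι R) (u v w : ι → R),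
    (∀ i j, A i j ∈ S) ∧ (∀ i, u i ∈ S) ∧ (∀ i, v i ∈ S) ∧
      A.det = 1 ∧ A *ᵥ w = v ∧ u ⬝ᵥ w = f

namespace IsBilinearRep

variable {R : Type*} [CommRing R] {S : Set R} {f g s : R}

open Matrix

theorem of_mem (h1 : 1 ∈ S) (hs : s ∈ S) : IsBilinearRep S s :=
  ⟨Unit, inferInstance, inferInstance, 1, fun _ => s, fun _ => 1, fun _ => 1,
    by simpa using h1, by simpa using hs, by simpa using h1, by simp, by simp,
    by simp [dotProduct]⟩

theorem add (h0 : 0 ∈ S) (hf : IsBilinearRep S f) (hg : IsBilinearRep S g) :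
    IsBilinearRep S (f + g) := by
  obtain ⟨ι, _, _, A, u, v, w, hA, hu, hv, hdet, hw, rfl⟩ := hf
  obtain ⟨κ, _, _, B, u', v', w', hB, hu', hv', hdet', hw', rfl⟩ := hg
  refine ⟨ι ⊕ κ, inferInstance, inferInstance, fromBlocks A 0 0 B, Sum.elim u u',
    Sum.elim v v', Sum.elim w w', ?_, ?_, ?_, ?_, ?_, ?_⟩
  · rintro (i | i) (j | j) <;> simp [hA, hB, h0]
  · rintro (i | i) <;> simp [hu, hu']
  · rintro (i | i) <;> simp [hv, hv']
  · simp [hdet, hdet']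
  · simp [fromBlocks_mulVec, hw, hw']
  · simp

theorem mul_left (h0 : 0 ∈ S) (h1 : 1 ∈ S) (hs : -s ∈ S) (hf : IsBilinearRep S f) :
    IsBilinearRep S (s * f) := by
  obtain ⟨ι, _, _, A, u, v, w, hA, hu, hv, hdet, hw, rfl⟩ := hf
  refine ⟨Unit ⊕ ι, inferInstance, inferInstance, fromBlocks 1 (replicateRow Unit u) 0 A,
    Sum.elim (fun _ => -s) 0, Sum.elim 0 v, Sum.elim (fun _ => -(u ⬝ᵥ w)) w,
    ?_, ?_, ?_, ?_, ?_, ?_⟩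
  · rintro (i | i) (j | j) <;> simp [hA, hu, h0, h1]
  · rintro (i | i) <;> simp [hs, h0]
  · rintro (i | i) <;> simp [hv, h0]
  · simp [hdet]
  · rw [fromBlocks_mulVec]
    ext (i | i)
    · simp [mulVec, dotProduct]
    · simp [hw]
  · simp [dotProduct]

theorem sum {ι : Type*} (t : Finset ι) (F : ι → R) (h0 : 0 ∈ S) (h1 : 1 ∈ S)
    (h : ∀ i ∈ t, IsBilinearRep S (F i)) : IsBilinearRep S (∑ i ∈ t, F i) :=
  Finset.sum_induction F _ (fun _ _ => add h0) (of_mem h1 h0) h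

theorem mul_prod_pow {ι : Type*} (t : Finset ι) (F : ι → R) (e : ι → ℕ) (h0 : 0 ∈ S)
    (h1 : 1 ∈ S) (h : ∀ i, -F i ∈ S) (hf : IsBilinearRep S f) :
    IsBilinearRep S (f * ∏ i ∈ t, F i ^ e i) := by
  refine Finset.prod_induction _ (fun p => ∀ f, IsBilinearRep S f → IsBilinearRep S (f * p))
    ?_ ?_ ?_ f hf
  · intro p q hp hq f hf
    rw [← mul_assoc]
    exact hq _ (hp _ hf)
  · simp
  · intro i _ f hf
    induction e i with
    | zero => simpa using hf
    | succ k ih =>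
      rw [pow_succ, ← mul_assoc, mul_comm]
      exact mul_left h0 h1 (h i) ih

theorem exists_det_eq (h0 : 0 ∈ S) (hneg : ∀ s ∈ S, -s ∈ S) (hf : IsBilinearRep S f) :
    ∃ (N : ℕ) (M : Matrix (Fin N) (Fin N) R), (∀ i j, M i j ∈ S) ∧ M.det = f := by
  obtain ⟨ι, _, _, A, u, v, w, hA, hu, hv, hdet, hw, rfl⟩ := hf
  let B := fromBlocks A (replicateCol Unit v) (replicateRow Unit (-u)) 0
  have hB : B.det = u ⬝ᵥ w := by
    have hmul : B * fromBlocks 1 (replicateCol Unit (-w)) 0 1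
        = fromBlocks A 0 (replicateRow Unit (-u)) (of fun _ _ => u ⬝ᵥ w) := by
      rw [fromBlocks_multiply]
      congr 1
      · simp
      · ext i j
        simp [← replicateCol_mulVec, mulVec_neg, hw]
      · simp
      · ext i j
        simp [Matrix.mul_apply, dotProduct]
    simpa [hdet] using congrArg det hmul
  let e := Fintype.equivFin (ι ⊕ Unit)
  refine ⟨_, reindex e e B, fun i j => ?_, by rw [det_reindex_self, hB]⟩
  have hmem : ∀ i j, B i j ∈ S := by
    rintro (i | i) (j | j) <;> simp [B, hA, hv, hu, hneg, h0]
  exact hmem _ _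

end IsBilinearRep

theorem exists_isUDR (K : Type*) [Field K] (n d : ℕ) :
    ∃ (N : ℕ) (M : Matrix (Fin N) (Fin N) (URing K n d)), IsUDR K n d N M := by
  set S := Submodule.span K (allowedMonomials K n d) with hS
  have h0 : (0 : URing K n d) ∈ (S : Set (URing K n d)) := S.zero_mem
  have h1 : (1 : URing K n d) ∈ (S : Set (URing K n d)) :=
    Submodule.subset_span (by simp [allowedMonomials])
  refine IsBilinearRep.exists_det_eq h0 (fun s hs => S.neg_mem hs) ?_
  refine IsBilinearRep.sum _ _ h0 h1 fun α _ => ?_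
  refine IsBilinearRep.mul_prod_pow _ _ _ h0 h1 (fun i => S.neg_mem ?_)
    (IsBilinearRep.of_mem h1 ?_)
  · exact Submodule.subset_span (by simp [allowedMonomials])
  · exact Submodule.subset_span (by simp [allowedMonomials])

theorem Derivation.apply_prod {R A M ι : Type*} [CommSemiring R] [CommSemiring A]
    [AddCommMonoid M] [Algebra R A] [Module A M] [Module R M] [DecidableEq ι]
    (D : Derivation R A M) (s : Finset ι) (f : ι → A) :
    D (∏ i ∈ s, f i) = ∑ i ∈ s, (∏ j ∈ s.erase i, f j) • D (f i) := by
  induction s using Finset.induction_on with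
  | empty => simp
  | insert a s ha ih =>
    rw [Finset.prod_insert ha, D.leibniz, ih, Finset.sum_insert ha, Finset.erase_insert ha,
      add_comm, Finset.smul_sum]
    congr 1
    refine Finset.sum_congr rfl fun i hi => ?_
    have hne : a ≠ i := fun h => ha (h ▸ hi)
    rw [Finset.erase_insert_of_ne hne, Finset.prod_insert (by simp [ha]), smul_smul]

open Matrix in
theorem Derivation.apply_det {R A ι : Type*} [CommRing R] [CommRing A] [Algebra R A]
    [Fintype ι] [DecidableEq ι] (D : Derivation R A A) (M : Matrix ι ι A) :
    D M.det = ∑ i, ∑ j, M.adjugate i j * D (M j i) := by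
  have hcol : ∀ i, ∑ j, M.adjugate i j * D (M j i)
      = (M.updateCol i fun j => D (M j i)).det := fun i => by
    rw [← cramer_apply, cramer_eq_adjugate_mulVec]
    rfl
  simp_rw [hcol, det_apply]
  rw [map_sum, Finset.sum_comm]
  refine Finset.sum_congr rfl fun σ _ => ?_
  rw [← Finset.smul_sum, Units.smul_def, Units.smul_def, map_zsmul, D.apply_prod]
  congr 1
  refine Finset.sum_congr rfl fun i _ => ?_
  rw [← Finset.mul_prod_erase _ _ (Finset.mem_univ i), smul_eq_mul, mul_comm]
  congr 1
  · simp
  · refine Finset.prod_congr rfl fun j hj => ?_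
    rw [updateCol_ne (Finset.ne_of_mem_erase hj)]

theorem killC_pderiv_genPoly (K : Type*) [Field K] (n d : ℕ) (α : ExpLE n d) :
    killC K n d (pderiv (Sum.inr α) (genPoly K n d)) = monomial α.1 1 := by
  have hx : ∀ β : ExpLE n d, pderiv (Sum.inr α : Fin n ⊕ ExpLE n d)
      (∏ i : Fin n, (X (Sum.inl i) : URing K n d) ^ (β.1 i)) = 0 := fun β => by
    rw [Derivation.apply_prod]
    refine Finset.sum_eq_zero fun i _ => ?_
    rw [Derivation.leibniz_pow, pderiv_X_of_ne (by simp)]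
    simp
  rw [genPoly, map_sum, map_sum, Finset.sum_eq_single α]
  · rw [Derivation.leibniz, hx, pderiv_X_self]
    simp [killC, monomial_eq, Finsupp.prod_fintype]
  · intro β _ hβ
    rw [Derivation.leibniz, hx, pderiv_X_of_ne (by simpa using hβ)]
    simp
  · simp

theorem killC_pderiv_mem_span {K : Type*} [Field K] {n d : ℕ} (α : ExpLE n d)
    {f : URing K n d} (hf : f ∈ Submodule.span K (allowedMonomials K n d)) :
    killC K n d (pderiv (Sum.inr α) f) ∈
      Submodule.span K (Set.range fun k : Option (Fin n) =>
        k.elim (1 : MvPolynomial (Fin n) K) X) := by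
  induction hf using Submodule.span_induction with
  | zero => simp
  | add f g _ _ hf hg => simpa using add_mem hf hg
  | smul c f _ hf => simpa using Submodule.smul_mem _ c hf
  | mem f hf =>
    rcases hf with ((rfl | ⟨i, rfl⟩) | ⟨β, rfl⟩) | ⟨⟨β, i⟩, rfl⟩
    · simp
    · simp
    · by_cases h : β = α
      · subst h
        exact Submodule.subset_span ⟨none, by simp⟩
      · simp [h]
    · by_cases h : β = α
      · subst h
        exact Submodule.subset_span ⟨some i, by simp [killC]⟩
      · simp [h]

theorem card_expLE_le_of_isUDR {K : Type*} [Field K] {n d N : ℕ}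
    {M : Matrix (Fin N) (Fin N) (URing K n d)} (hM : IsUDR K n d N M) :
    Fintype.card (ExpLE n d) ≤ (n + 1) * N ^ 2 := by
  let g : (Fin N × Fin N) × Option (Fin n) → MvPolynomial (Fin n) K := fun p =>
    killC K n d (M.adjugate p.1.1 p.1.2) * p.2.elim 1 X
  have hmem : ∀ α : ExpLE n d,
      (monomial α.1 1 : MvPolynomial (Fin n) K) ∈ Submodule.span K (Set.range g) := by
    intro α
    rw [← killC_pderiv_genPoly, ← hM.2, Derivation.apply_det]
    simp only [map_sum, map_mul]
    refine sum_mem fun i _ => sum_mem fun j _ => ?_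
    have hij := Submodule.mem_map_of_mem
      (f := LinearMap.mulLeft K (killC K n d (M.adjugate i j)))
      (killC_pderiv_mem_span α (hM.1 j i))
    rw [Submodule.map_span] at hij
    refine Submodule.span_mono ?_ hij
    rintro _ ⟨_, ⟨k, rfl⟩, rfl⟩
    exact ⟨((i, j), k), rfl⟩
  have hli : LinearIndependent K fun α : ExpLE n d =>
      (⟨monomial α.1 1, hmem α⟩ : Submodule.span K (Set.range g)) := by
    refine LinearIndependent.of_comp (Submodule.subtype _) ?_
    have := (basisMonomials (Fin n) K).linearIndependent.comp
      (fun α : ExpLE n d => α.1) Subtype.val_injective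
    simpa [Function.comp_def] using this
  have hfin : Module.Finite K (Submodule.span K (Set.range g)) :=
    Module.Finite.span_of_finite K (Set.finite_range g)
  calc Fintype.card (ExpLE n d) ≤ Module.finrank K (Submodule.span K (Set.range g)) :=
        hli.fintype_card_le_finrank
    _ ≤ Fintype.card ((Fin N × Fin N) × Option (Fin n)) := finrank_range_le_card g
    _ = (n + 1) * N ^ 2 := by simp; ring

theorem succ_div_pow_le_card_expLE (n d : ℕ) :
    (d / n + 1) ^ n ≤ Fintype.card (ExpLE n d) := by
  have hle : ∀ a : Fin n → Fin (d / n + 1),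
      ((Finsupp.equivFunOnFinite.symm fun i => (a i : ℕ)).sum fun _ e => e) ≤ d := by
    intro a
    rw [Finsupp.sum_fintype _ _ (by simp)]
    calc ∑ i, (a i : ℕ) ≤ ∑ _i : Fin n, d / n :=
          Finset.sum_le_sum fun i _ => Nat.lt_succ_iff.mp (a i).2
      _ ≤ d := by simpa using Nat.mul_div_le d n
  have hinj : Function.Injective fun a : Fin n → Fin (d / n + 1) =>
      (⟨Finsupp.equivFunOnFinite.symm fun i => (a i : ℕ), hle a⟩ : ExpLE n d) := by
    intro a b hab
    ext i
    exact DFunLike.congr_fun (congrArg Subtype.val hab) i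
  simpa using Fintype.card_le_of_injective (β := ExpLE n d) _ hinj

theorem pow_le_mul_sq_of_isUDR {K : Type*} [Field K] {n d N : ℕ} (hn : n ≠ 0)
    {M : Matrix (Fin N) (Fin N) (URing K n d)} (hM : IsUDR K n d N M) :
    d ^ n ≤ n ^ n * (n + 1) * N ^ 2 := by
  calc d ^ n ≤ (n * (d / n + 1)) ^ n :=
        Nat.pow_le_pow_left (Nat.lt_mul_div_succ d (Nat.pos_of_ne_zero hn)).le n
    _ = n ^ n * (d / n + 1) ^ n := mul_pow ..
    _ ≤ n ^ n * ((n + 1) * N ^ 2) := Nat.mul_le_mul_left _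
        ((succ_div_pow_le_card_expLE n d).trans (card_expLE_le_of_isUDR hM))
    _ = n ^ n * (n + 1) * N ^ 2 := (mul_assoc ..).symm

/-- Theorem 1.3, lower bound. For a field `K` and fixed `n ≥ 2` there is a
constant `C₁ > 0` such that for all `d ≥ 1` the minimal size `N*(n,d)` of a uniform
determinantal representation of the generic degree-`d` polynomial in `n` variables satisfies
`N*(n,d) ≥ C₁ · d^(n/2)`. -/
theorem Nstar_lower_bound (K : Type*) [Field K] (n : ℕ) (hn : 2 ≤ n) :
    ∃ C₁ : ℝ, 0 < C₁ ∧ ∀ d : ℕ, 1 ≤ d →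
      C₁ * (d : ℝ) ^ ((n : ℝ) / 2) ≤ (Nstar K n d : ℝ) := by
  have hpos : (0 : ℝ) < n ^ n * (n + 1) := by positivity
  refine ⟨(√(n ^ n * (n + 1)))⁻¹, by positivity, fun d _ => ?_⟩
  obtain ⟨M, hM⟩ := Nat.sInf_mem (exists_isUDR K n d)
  have hle : (d : ℝ) ^ n ≤ n ^ n * (n + 1) * (Nstar K n d : ℝ) ^ 2 := by
    exact_mod_cast pow_le_mul_sq_of_isUDR (by lia) hM
  have hsqrt : (d : ℝ) ^ ((n : ℝ) / 2) = √((d : ℝ) ^ n) := by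
    rw [Real.sqrt_eq_rpow, ← Real.rpow_natCast_mul d.cast_nonneg, mul_one_div]
  rw [hsqrt, inv_mul_le_iff₀ (by positivity)]
  refine (Real.sqrt_le_sqrt hle).trans_eq ?_
  rw [Real.sqrt_mul hpos.le, Real.sqrt_sq (Nat.cast_nonneg _)]
end

section
/- Let K be a field and fix an integer n ≥ 2. There exists a constant C₂ > 0 (depending on n but not on d) such that for every integer d ≥ 1, the minimal size N*(n,d) of a uniform determinantal representation of the generic polynomial of degree d in n variables satisfies N*(n,d) ≤ C₂ · d^(n/2) (with d^(n/2) interpreted as the real number (d:ℝ)^(n/2)). -/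
open MvPolynomial

section Determinant

open Matrix

variable {R : Type*} [CommRing R] {ι κ : Type*} [Fintype ι] [DecidableEq ι]
  [Fintype κ] [DecidableEq κ]

/-- A bordered determinant whose border column lies in the column space. -/
lemma det_bordered_mulVec (A : Matrix ι ι R) (u w : ι → R) :
    (fromBlocks A (replicateCol Unit (A *ᵥ w)) (replicateRow Unit (-u)) 0).det =
      A.det * (u ⬝ᵥ w) := by
  have h : fromBlocks A (replicateCol Unit (A *ᵥ w)) (replicateRow Unit (-u)) 0 =
      fromBlocks A 0 (replicateRow Unit (-u)) (1 : Matrix Unit Unit R) *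
        fromBlocks 1 (replicateCol Unit w) 0 (of fun _ _ => u ⬝ᵥ w) := by
    rw [fromBlocks_multiply]
    congr 1
    · simp
    · simp [replicateCol_mulVec]
    · simp
    · ext i j
      simp [Matrix.mul_apply, dotProduct]
  rw [h, det_mul, det_fromBlocks_zero₁₂, det_fromBlocks_zero₂₁]
  simp

/-- The matrix whose determinant realizes the bilinear expression `gᵀ L f`, when `P f` and `Q g`
are basis vectors. -/
def bilinearBlock (P : Matrix ι ι R) (Q : Matrix κ κ R) (L : Matrix κ ι R) (i₀ : ι) (k₀ : κ) :
    Matrix ((ι ⊕ κ) ⊕ Unit) ((ι ⊕ κ) ⊕ Unit) R :=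
  fromBlocks (fromBlocks P 0 (-L) Qᵀ) (replicateCol Unit (Sum.elim (Pi.single i₀ 1) 0))
    (replicateRow Unit (-Sum.elim (0 : ι → R) (Pi.single k₀ 1))) 0

lemma det_bilinearBlock (P : Matrix ι ι R) (Q : Matrix κ κ R) (L : Matrix κ ι R) (i₀ : ι) (k₀ : κ)
    (f : ι → R) (g : κ → R) (hP : P.det = 1) (hQ : Q.det = 1)
    (hf : P *ᵥ f = Pi.single i₀ 1) (hg : Q *ᵥ g = Pi.single k₀ 1) :
    (bilinearBlock P Q L i₀ k₀).det = g ⬝ᵥ (L *ᵥ f) := by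
  have hQT : IsUnit Qᵀ.det := by simp [det_transpose, hQ]
  obtain ⟨h, hQh⟩ : ∃ h : κ → R, Qᵀ *ᵥ h = L *ᵥ f :=
    ⟨Qᵀ⁻¹ *ᵥ (L *ᵥ f), by rw [mulVec_mulVec, mul_nonsing_inv _ hQT, one_mulVec]⟩
  have hw : fromBlocks P 0 (-L) Qᵀ *ᵥ Sum.elim f h = Sum.elim (Pi.single i₀ 1) 0 := by
    rw [fromBlocks_mulVec]
    simp [hf, hQh, neg_mulVec]
  rw [bilinearBlock, ← hw, det_bordered_mulVec, det_fromBlocks_zero₁₂, det_transpose, hP, hQ,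
    sumElim_dotProduct_sumElim, zero_dotProduct, zero_add, one_mul, one_mul, ← hg, ← hQh,
    dotProduct_mulVec g, vecMul_transpose]

end Determinant

/-- A set of exponent vectors each nonzero member of which stays in the set after decreasing a
suitable coordinate by one. -/
def ExpConnected {n : ℕ} (S : Finset (Fin n → ℕ)) : Prop :=
  0 ∈ S ∧ ∀ a ∈ S, a ≠ 0 → ∃ b ∈ S, ∃ i, a = b + Pi.single i 1

lemma Nstar_le_card {K : Type*} [Field K] {n d : ℕ} {ι : Type*} [Fintype ι] [DecidableEq ι]
    (M : Matrix ι ι (URing K n d))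
    (hM : ∀ i j, M i j ∈ Submodule.span K (allowedMonomials K n d))
    (hdet : M.det = genPoly K n d) : Nstar K n d ≤ Fintype.card ι := by
  refine Nat.sInf_le ⟨M.submatrix (Fintype.equivFin ι).symm (Fintype.equivFin ι).symm,
    fun i j => hM _ _, ?_⟩
  rw [Matrix.det_submatrix_equiv_self, hdet]

/-- The monomial in the `x`-variables with the given exponents. -/
noncomputable def xMonomial (K : Type*) [Field K] {n : ℕ} (d : ℕ) (a : Fin n → ℕ) : URing K n d :=
  ∏ i, X (Sum.inl i) ^ a i

lemma xMonomial_zero (K : Type*) [Field K] {n d : ℕ} :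
    xMonomial K d (0 : Fin n → ℕ) = 1 := by
  simp [xMonomial]

lemma xMonomial_add (K : Type*) [Field K] {n d : ℕ} (a b : Fin n → ℕ) :
    xMonomial K d (a + b) = xMonomial K d a * xMonomial K d b := by
  simp [xMonomial, pow_add, Finset.prod_mul_distrib]

lemma xMonomial_single (K : Type*) [Field K] {n d : ℕ} (i : Fin n) :
    xMonomial K d (Pi.single i 1) = X (Sum.inl i) := by
  rw [xMonomial, Finset.prod_eq_single i] <;> simp +contextual

section Allowed

variable (K : Type*) [Field K] (n d : ℕ)

lemma one_mem_span_allowed :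
    (1 : URing K n d) ∈ Submodule.span K (allowedMonomials K n d) :=
  Submodule.subset_span (Or.inl (Or.inl (Or.inl rfl)))

lemma X_inl_mem_span_allowed (i : Fin n) :
    (X (Sum.inl i) : URing K n d) ∈ Submodule.span K (allowedMonomials K n d) :=
  Submodule.subset_span (Or.inl (Or.inl (Or.inr ⟨i, rfl⟩)))

lemma X_inr_mem_span_allowed (α : ExpLE n d) :
    (X (Sum.inr α) : URing K n d) ∈ Submodule.span K (allowedMonomials K n d) :=
  Submodule.subset_span (Or.inl (Or.inr ⟨α, rfl⟩))

end Allowed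

/-- A connected set of monomials is the solution of a unimodular linear system with affine-linear
coefficients. -/
lemma ExpConnected.exists_matrix (K : Type*) [Field K] {n : ℕ} (d : ℕ) {S : Finset (Fin n → ℕ)}
    (hS : ExpConnected S) :
    ∃ P : Matrix S S (URing K n d),
      (∀ a b, P a b ∈ Submodule.span K (allowedMonomials K n d)) ∧ P.det = 1 ∧
      P.mulVec (fun a => xMonomial K d a.1) = Pi.single ⟨0, hS.1⟩ 1 := by
  have hpar : ∀ a : S, ∃ b : S, ∃ y ∈ Submodule.span K (allowedMonomials K n d), a.1 ≠ 0 →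
      xMonomial K d a.1 = y * xMonomial K d b.1 ∧ ∑ i, b.1 i < ∑ i, a.1 i := by
    intro a
    by_cases h : a.1 = 0
    · exact ⟨a, 0, Submodule.zero_mem _, fun h' => absurd h h'⟩
    · obtain ⟨b, hb, i, hi⟩ := hS.2 a.1 a.2 h
      refine ⟨⟨b, hb⟩, X (Sum.inl i), X_inl_mem_span_allowed K n d i, fun _ => ⟨?_, ?_⟩⟩
      · rw [hi, xMonomial_add, xMonomial_single, mul_comm]
      · simp [hi, Finset.sum_add_distrib]
  choose p y hy hpy using hpar
  set N : Matrix S S (URing K n d) :=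
    Matrix.of fun a b => if a.1 ≠ 0 ∧ p a = b then y a else 0 with hN
  refine ⟨1 - N, fun a b => ?_, ?_, ?_⟩
  · rw [Matrix.sub_apply]
    refine Submodule.sub_mem _ ?_ ?_
    · rw [Matrix.one_apply]
      split_ifs
      exacts [one_mem_span_allowed K n d, Submodule.zero_mem _]
    · rw [hN, Matrix.of_apply]
      split_ifs
      exacts [hy a, Submodule.zero_mem _]
  · have hN0 : ∀ a b : S, ∑ i, a.1 i ≤ ∑ i, b.1 i → N a b = 0 := by
      intro a b hab
      rw [hN, Matrix.of_apply, if_neg]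
      rintro ⟨ha, rfl⟩
      exact absurd (hpy a ha).2 (not_lt.2 hab)
    have htri : (1 - N).BlockTriangular fun a : S => OrderDual.toDual (∑ i, a.1 i) := by
      intro a b hab
      have hab' : ∑ i, a.1 i < ∑ i, b.1 i := hab
      rw [Matrix.sub_apply, hN0 a b hab'.le, Matrix.one_apply_ne, sub_zero]
      rintro rfl
      exact lt_irrefl _ hab'
    rw [htri.det]
    refine Finset.prod_eq_one fun k _ => ?_
    have : (1 - N).toSquareBlock (fun a : S => OrderDual.toDual (∑ i, a.1 i)) k = 1 := by
      ext ⟨a, ha⟩ ⟨b, hb⟩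
      have hab : ∑ i, a.1 i = ∑ i, b.1 i := ha.trans hb.symm
      simp [Matrix.toSquareBlock_def, hN0 a b hab.le, Matrix.one_apply]
    rw [this, Matrix.det_one]
  · funext a
    rw [Matrix.sub_mulVec, Matrix.one_mulVec, Pi.sub_apply, Matrix.mulVec, dotProduct]
    by_cases ha : a.1 = 0
    · obtain rfl : a = ⟨0, hS.1⟩ := Subtype.ext ha
      simp [hN, xMonomial_zero]
    · have hne : a ≠ ⟨0, hS.1⟩ := fun h => ha (congrArg Subtype.val h)
      rw [Pi.single_eq_of_ne hne, sub_eq_zero]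
      rw [(hpy a ha).1]
      simp [hN, ha]

lemma Nstar_le_of_connected (K : Type*) [Field K] {n d : ℕ} {A B : Finset (Fin n → ℕ)}
    (hA : ExpConnected A) (hB : ExpConnected B)
    (hAB : ∀ α : Fin n → ℕ, (∀ i, α i ≤ d) → ∃ a ∈ A, ∃ b ∈ B, α = a + b) :
    Nstar K n d ≤ A.card + B.card + 1 := by
  obtain ⟨P, hPmem, hPdet, hPf⟩ := hA.exists_matrix K d
  obtain ⟨Q, hQmem, hQdet, hQg⟩ := hB.exists_matrix K d
  have hsplit : ∀ α : ExpLE n d, ∃ a : A, ∃ b : B, ∀ i, α.1 i = a.1 i + b.1 i := by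
    intro α
    obtain ⟨a, ha, b, hb, h⟩ := hAB α.1 fun i => by
      refine le_trans ?_ α.2
      rw [Finsupp.sum_fintype _ _ fun _ => rfl]
      exact Finset.single_le_sum (f := fun j => α.1 j) (fun _ _ => Nat.zero_le _)
        (Finset.mem_univ i)
    exact ⟨⟨a, ha⟩, ⟨b, hb⟩, fun i => congrFun h i⟩
  choose p q hpq using hsplit
  set L : Matrix B A (URing K n d) :=
    Matrix.of fun b a => ∑ α, if q α = b ∧ p α = a then X (Sum.inr α) else 0 with hL
  have hLmem : ∀ b a, L b a ∈ Submodule.span K (allowedMonomials K n d) := by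
    intro b a
    rw [hL, Matrix.of_apply]
    refine Submodule.sum_mem _ fun α _ => ?_
    split_ifs
    exacts [X_inr_mem_span_allowed K n d α, Submodule.zero_mem _]
  have hsingle : ∀ {ι : Type} [DecidableEq ι] (i j : ι),
      (Pi.single i 1 : ι → URing K n d) j ∈ Submodule.span K (allowedMonomials K n d) := by
    intro ι _ i j
    rw [Pi.single_apply]
    split_ifs
    exacts [one_mem_span_allowed K n d, Submodule.zero_mem _]
  refine (Nstar_le_card (bilinearBlock P Q L ⟨0, hA.1⟩ ⟨0, hB.1⟩) ?_ ?_).trans_eq (by simp)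
  · rintro ((i | i) | i) ((j | j) | j)
    · exact hPmem i j
    · exact Submodule.zero_mem _
    · exact hsingle _ _
    · exact Submodule.neg_mem _ (hLmem i j)
    · exact hQmem j i
    · exact Submodule.zero_mem _
    · exact Submodule.neg_mem _ (Submodule.zero_mem _)
    · exact Submodule.neg_mem _ (hsingle _ _)
    · exact Submodule.zero_mem _
  · rw [det_bilinearBlock P Q L _ _ _ _ hPdet hQdet hPf hQg]
    have hmono : ∀ α : ExpLE n d, (∏ i, X (Sum.inl i) ^ α.1 i : URing K n d) =
        xMonomial K d (q α).1 * xMonomial K d (p α).1 := by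
      intro α
      rw [← xMonomial_add, xMonomial]
      exact Finset.prod_congr rfl fun i _ => by rw [hpq α i, Pi.add_apply, add_comm]
    simp only [genPoly, hmono, dotProduct, Matrix.mulVec, hL, Matrix.of_apply, Finset.sum_mul,
      Finset.mul_sum]
    rw [Finset.sum_congr rfl fun b _ => Finset.sum_comm, Finset.sum_comm]
    refine Finset.sum_congr rfl fun α _ => ?_
    rw [Finset.sum_eq_single (q α), Finset.sum_eq_single (p α)]
    · simp only [and_self, if_true]
      ring
    · intro a _ ha
      simp [ha.symm]
    · simp
    · intro b _ hb
      simp [hb.symm]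
    · simp

lemma expConnected_piFinset_range {n : ℕ} (k : Fin n → ℕ) (hk : ∀ i, 0 < k i) :
    ExpConnected (Fintype.piFinset fun i => Finset.range (k i)) := by
  refine ⟨by simpa using hk, fun a ha h0 => ?_⟩
  obtain ⟨i, hi⟩ := Function.ne_iff.1 h0
  have hi' : a i ≠ 0 := hi
  simp only [Fintype.mem_piFinset, Finset.mem_range] at ha
  refine ⟨a - Pi.single i 1, ?_, i, ?_⟩
  · simp only [Fintype.mem_piFinset, Finset.mem_range]
    exact fun j => (Nat.sub_le _ _).trans_lt (ha j)
  · funext j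
    rcases eq_or_ne j i with rfl | hj
    · simp; omega
    · simp [hj]

/-- The function on `Fin n` equal to `a`, `b`, `c` on the first `t`, the next `t` and the remaining
indices. -/
def threeBlocks {β : Type*} (n t : ℕ) (a b c : β) (i : Fin n) : β :=
  if i.1 < t then a else if i.1 < t + t then b else c

lemma prod_threeBlocks (t r a b c : ℕ) :
    ∏ i, threeBlocks (t + t + r) t a b c i = a ^ t * b ^ t * c ^ r := by
  unfold threeBlocks
  rw [Fin.prod_univ_eq_prod_range
    (fun i => if i < t then a else if i < t + t then b else c), Finset.prod_range_add,
    Finset.prod_range_add]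
  congr 1
  · congr 1
    · rw [Finset.prod_congr rfl fun i hi => if_pos (Finset.mem_range.1 hi)]
      simp
    · rw [Finset.prod_congr rfl fun i hi => by
        rw [if_neg (by omega), if_pos (by simpa using hi)]]
      simp
  · rw [Finset.prod_congr rfl fun i _ => by rw [if_neg (by omega), if_neg (by omega)]]
    simp

/-- The bound on `N*` from splitting the variables in two halves, a remaining variable being
written in base `s`. -/
lemma Nstar_le_of_lt_mul_self (K : Type*) [Field K] (t r d s : ℕ) (hs : d < s * s) :
    Nstar K (t + t + r) d ≤ (d + 1) ^ t * s ^ r + (s * s) ^ r + (d + 1) ^ t * s ^ r + 1 := by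
  have hs0 : 0 < s := Nat.pos_of_ne_zero fun h => by simp [h] at hs
  set n := t + t + r
  set A₁ : Finset (Fin n → ℕ) := Fintype.piFinset
    (threeBlocks n t (Finset.range (d + 1)) {0} ((Finset.range s).image (· * s))) with hA₁
  set A₂ : Finset (Fin n → ℕ) := Fintype.piFinset
    fun i => Finset.range (threeBlocks n t 1 1 (s * s) i) with hA₂
  set B : Finset (Fin n → ℕ) := Fintype.piFinset
    fun i => Finset.range (threeBlocks n t 1 (d + 1) s i) with hB
  have hA₂c : ExpConnected A₂ := expConnected_piFinset_range _ fun i => by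
    unfold threeBlocks; split_ifs <;> positivity
  have hBc : ExpConnected B := expConnected_piFinset_range _ fun i => by
    unfold threeBlocks; split_ifs <;> positivity
  have hAc : ExpConnected (A₁ ∪ A₂) := by
    refine ⟨Finset.mem_union_right _ hA₂c.1, fun a ha h0 => ?_⟩
    by_cases ha₂ : a ∈ A₂
    · obtain ⟨b, hb, h⟩ := hA₂c.2 a ha₂ h0
      exact ⟨b, Finset.mem_union_right _ hb, h⟩
    have ha₁ : ∀ i, a i ∈ threeBlocks n t (Finset.range (d + 1)) {0}
        ((Finset.range s).image (· * s)) i :=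
      Fintype.mem_piFinset.1 ((Finset.mem_union.1 ha).resolve_right ha₂)
    obtain ⟨i, hit, hi⟩ : ∃ i : Fin n, i.1 < t ∧ a i ≠ 0 := by
      by_contra! hcon
      refine ha₂ (Fintype.mem_piFinset.2 fun i => ?_)
      have := ha₁ i
      unfold threeBlocks at this ⊢
      split_ifs at this ⊢ with h₁ h₂
      · simpa using hcon i h₁
      · simpa using this
      · obtain ⟨m, hm, hma⟩ := Finset.mem_image.1 this
        rw [Finset.mem_range, ← hma]
        exact Nat.mul_lt_mul_of_pos_right (Finset.mem_range.1 hm) hs0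
    refine ⟨a - Pi.single i 1, Finset.mem_union_left _ (Fintype.mem_piFinset.2 fun j => ?_), i, ?_⟩
    · rcases eq_or_ne j i with rfl | hj
      · have := ha₁ j
        simp only [threeBlocks, hit, if_true, Finset.mem_range, Pi.sub_apply] at this ⊢
        omega
      · simpa [hj] using ha₁ j
    · funext j
      rcases eq_or_ne j i with rfl | hj
      · simp; omega
      · simp [hj]
  refine (Nstar_le_of_connected K hAc hBc fun α hα => ?_).trans ?_
  · refine ⟨fun i => threeBlocks n t (α i) 0 (α i / s * s) i, Finset.mem_union_left _
      (Fintype.mem_piFinset.2 fun i => ?_), fun i => threeBlocks n t 0 (α i) (α i % s) i,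
      Fintype.mem_piFinset.2 fun i => ?_, funext fun i => ?_⟩
    · unfold threeBlocks
      split_ifs
      · simpa [Nat.lt_succ_iff] using hα i
      · simp
      · exact Finset.mem_image_of_mem _ (Finset.mem_range.2
          (Nat.div_lt_of_lt_mul ((hα i).trans_lt hs)))
    · unfold threeBlocks
      split_ifs
      · simp
      · simpa [Nat.lt_succ_iff] using hα i
      · simpa using Nat.mod_lt _ hs0
    · rw [Pi.add_apply]
      unfold threeBlocks
      split_ifs
      · simp
      · simp
      · exact (Nat.div_add_mod' _ _).symm
  · have hprod : ∀ a b c : ℕ, ∏ i, threeBlocks n t a b c i = a ^ t * b ^ t * c ^ r :=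
      prod_threeBlocks t r
    have hcA₁ : A₁.card ≤ (d + 1) ^ t * s ^ r := by
      rw [hA₁, Fintype.card_piFinset]
      refine (Finset.prod_le_prod' (g := threeBlocks n t (d + 1) 1 s) fun i _ => ?_).trans_eq ?_
      · unfold threeBlocks
        split_ifs
        · simp
        · simp
        · exact Finset.card_image_le.trans_eq (Finset.card_range s)
      · simp [hprod]
    have hcA₂ : A₂.card = (s * s) ^ r := by
      simp [hA₂, Fintype.card_piFinset, hprod]
    have hcB : B.card = (d + 1) ^ t * s ^ r := by
      simp [hB, Fintype.card_piFinset, hprod]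
    have := Finset.card_union_le A₁ A₂
    omega

/-- Theorem 1.3, upper bound. For a field `K` and fixed `n ≥ 2` there is a
constant `C₂ > 0` such that for all `d ≥ 1` the minimal size `N*(n,d)` of a uniform
determinantal representation of the generic degree-`d` polynomial in `n` variables satisfies
`N*(n,d) ≤ C₂ · d^(n/2)`. -/
theorem Nstar_upper_bound (K : Type*) [Field K] (n : ℕ) (hn : 2 ≤ n) :
    ∃ C₂ : ℝ, 0 < C₂ ∧ ∀ d : ℕ, 1 ≤ d →
      (Nstar K n d : ℝ) ≤ C₂ * (d : ℝ) ^ ((n : ℝ) / 2) := by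
  obtain ⟨t, r, ht, hr, rfl⟩ : ∃ t r : ℕ, 1 ≤ t ∧ r ≤ 1 ∧ n = t + t + r :=
    ⟨n / 2, n % 2, by omega, by omega, by omega⟩
  refine ⟨2 * (2 ^ t * 2 ^ r) + 4 ^ r + 1, by positivity, fun d hd => ?_⟩
  have hd1 : (1 : ℝ) ≤ d := by exact_mod_cast hd
  have hd0 : (0 : ℝ) ≤ d := by linarith
  have hsq : (1 : ℝ) ≤ √d := Real.one_le_sqrt.2 hd1
  have hs : ((d.sqrt + 1 : ℕ) : ℝ) ≤ 2 * √d := by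
    have := Real.nat_sqrt_le_real_sqrt (a := d)
    push_cast
    linarith
  have hpow : (d : ℝ) ^ (((t + t + r : ℕ) : ℝ) / 2) = (d : ℝ) ^ t * √d ^ r := by
    rw [Real.sqrt_eq_rpow, ← Real.rpow_natCast, ← Real.rpow_natCast, ← Real.rpow_mul hd0,
      ← Real.rpow_add (by linarith)]
    congr 1
    push_cast
    ring
  rw [hpow]
  have h := Nstar_le_of_lt_mul_self K t r d (d.sqrt + 1) (Nat.lt_succ_sqrt d)
  have h' : (Nstar K (t + t + r) d : ℝ) ≤ ((d : ℝ) + 1) ^ t * ((d.sqrt + 1 : ℕ) : ℝ) ^ r +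
      (((d.sqrt + 1 : ℕ) : ℝ) * ((d.sqrt + 1 : ℕ) : ℝ)) ^ r +
      ((d : ℝ) + 1) ^ t * ((d.sqrt + 1 : ℕ) : ℝ) ^ r + 1 := by exact_mod_cast h
  have hmain : ((d : ℝ) + 1) ^ t * ((d.sqrt + 1 : ℕ) : ℝ) ^ r ≤
      (2 ^ t * 2 ^ r) * ((d : ℝ) ^ t * √d ^ r) := by
    calc ((d : ℝ) + 1) ^ t * ((d.sqrt + 1 : ℕ) : ℝ) ^ r ≤ (2 * d) ^ t * (2 * √d) ^ r := by
          gcongr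
          linarith
      _ = _ := by rw [mul_pow, mul_pow]; ring
  have haxis : (((d.sqrt + 1 : ℕ) : ℝ) * ((d.sqrt + 1 : ℕ) : ℝ)) ^ r ≤
      4 ^ r * ((d : ℝ) ^ t * √d ^ r) := by
    calc (((d.sqrt + 1 : ℕ) : ℝ) * ((d.sqrt + 1 : ℕ) : ℝ)) ^ r
        ≤ ((2 * √d) * (2 * √d)) ^ r := by gcongr
      _ = 4 ^ r * ((d : ℝ) ^ r * 1) := by
          rw [mul_one, ← mul_pow, mul_mul_mul_comm, Real.mul_self_sqrt hd0]
          norm_num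
      _ ≤ 4 ^ r * ((d : ℝ) ^ t * √d ^ r) := by
          gcongr ?_ * (?_ * ?_)
          · exact pow_le_pow_right₀ hd1 (hr.trans ht)
          · exact one_le_pow₀ hsq
  have hone : (1 : ℝ) ≤ (d : ℝ) ^ t * √d ^ r :=
    one_le_mul_of_one_le_of_one_le (one_le_pow₀ hd1) (one_le_pow₀ hsq)
  linarith
end

section
/- Let K be a field, n ≥ 1, d ≥ 0, and let M = M₀ + M₁ be a uniform determinantal representation of p_{n,d} of size N. Then: (i) det(M₀) is the zero polynomial in K[x_1,…,x_n]; and (ii) for every point x̄ ∈ Kⁿ, the matrix M₀(x̄) ∈ K^{N×N} obtained by evaluating the entries of M₀ at x̄ has rank exactly N−1. -/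
open MvPolynomial

namespace Matrix

variable {K : Type*} [Field K] {m : Type*} [Fintype m] [DecidableEq m]

theorem rank_lt_card_of_det_eq_zero {A : Matrix m m K} (hA : A.det = 0) :
    A.rank < Fintype.card m := by
  refine lt_of_le_of_ne A.rank_le_card_width fun h => ?_
  have hli : LinearIndependent K A.row := by
    rw [linearIndependent_iff_card_eq_finrank_span, Set.finrank, ← rank_eq_finrank_span_row, h]
  rw [linearIndependent_rows_iff_isUnit, isUnit_iff_isUnit_det, hA] at hli
  exact not_isUnit_zero hli

theorem rank_updateRow_le (A : Matrix m m K) (i : m) (v : m → K) :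
    (A.updateRow i v).rank ≤ A.rank + 1 := by
  rw [rank_eq_finrank_span_row, rank_eq_finrank_span_row]
  have hle : Submodule.span K (Set.range (A.updateRow i v).row) ≤
      Submodule.span K (Set.range A.row) ⊔ Submodule.span K {v} := by
    rw [Submodule.span_le]
    rintro _ ⟨j, rfl⟩
    by_cases hj : j = i
    · subst hj
      have hrow : (A.updateRow j v).row j = v := updateRow_self
      rw [hrow]
      exact Submodule.mem_sup_right (Submodule.mem_span_singleton_self v)
    · have hrow : (A.updateRow i v).row j = A.row j := updateRow_ne hj
      rw [hrow]
      exact Submodule.mem_sup_left (Submodule.subset_span ⟨j, rfl⟩)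
  calc _ ≤ _ := Submodule.finrank_mono hle
    _ ≤ _ := Submodule.finrank_add_le_finrank_add_finrank _ _
    _ ≤ _ := Nat.add_le_add_left ((finrank_span_le_card {v}).trans (by simp)) _

theorem card_le_rank_add_one_of_adjugate_ne_zero {A : Matrix m m K} (hA : A.adjugate ≠ 0) :
    Fintype.card m ≤ A.rank + 1 := by
  obtain ⟨i, j, hij⟩ : ∃ i j, A.adjugate i j ≠ 0 := by
    by_contra! h
    exact hA (Matrix.ext h)
  rw [adjugate_apply] at hij
  rw [← rank_of_det_ne_zero hij]
  exact rank_updateRow_le A j _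

/-- If the determinant of a polynomial matrix `P` is the variable, then the rank of `P(0)` drops
by at most one: otherwise `X` divides the adjugate of `P`, making `P` invertible. -/
theorem card_le_rank_map_eval_zero_add_one {P : Matrix m m (Polynomial K)}
    (hP : P.det = Polynomial.X) :
    Fintype.card m ≤ (P.map (Polynomial.evalRingHom 0)).rank + 1 := by
  refine card_le_rank_add_one_of_adjugate_ne_zero fun h => ?_
  have hadj : (Polynomial.evalRingHom (0 : K)).mapMatrix P.adjugate = 0 := by
    rw [RingHom.map_adjugate]
    exact h
  have hdvd : ∀ i j, ∃ q, P.adjugate i j = Polynomial.X * q := fun i j => by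
    have hij := congrFun₂ hadj i j
    rw [RingHom.mapMatrix_apply, map_apply, Polynomial.coe_evalRingHom,
      ← Polynomial.coeff_zero_eq_eval_zero] at hij
    exact Polynomial.X_dvd_iff.mpr hij
  choose Q hQ using hdvd
  have hPQ : P * of Q = 1 := by
    have hsmul : P.adjugate = (Polynomial.X : Polynomial K) • of Q := Matrix.ext hQ
    have hmul := P.mul_adjugate
    rw [hsmul, hP, Matrix.mul_smul] at hmul
    exact smul_right_injective _ Polynomial.X_ne_zero hmul
  have hunit := isUnit_det_of_right_inverse hPQ
  rw [hP] at hunit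
  exact Polynomial.not_isUnit_X hunit

end Matrix

theorem killC_genPoly (K : Type*) [Field K] (n d : ℕ) : killC K n d (genPoly K n d) = 0 := by
  simp [killC, genPoly]

/-- Specialize `x` to a point, the constant coefficient to the variable `X`, and every other
coefficient to zero. -/
noncomputable def specializeConstCoeff {K : Type*} [Field K] {n : ℕ} (d : ℕ) (x : Fin n → K) :
    URing K n d →ₐ[K] Polynomial K :=
  aeval (Sum.elim (fun i => Polynomial.C (x i)) fun α => if α.1 = 0 then Polynomial.X else 0)

theorem specializeConstCoeff_X_inr {K : Type*} [Field K] {n d : ℕ} (x : Fin n → K)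
    (α : ExpLE n d) :
    specializeConstCoeff d x (X (Sum.inr α)) = if α.1 = 0 then Polynomial.X else 0 :=
  aeval_X _ _

theorem specializeConstCoeff_genPoly {K : Type*} [Field K] {n : ℕ} (d : ℕ) (x : Fin n → K) :
    specializeConstCoeff d x (genPoly K n d) = Polynomial.X := by
  obtain ⟨z, hz⟩ : ∃ z : ExpLE n d, z.1 = 0 := ⟨⟨0, by simp⟩, rfl⟩
  rw [genPoly, map_sum]
  refine (Fintype.sum_eq_single z fun α hα => ?_).trans ?_
  · have hne : α.1 ≠ 0 := fun h => hα (Subtype.ext (h.trans hz.symm))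
    rw [map_mul, specializeConstCoeff_X_inr, if_neg hne, zero_mul]
  · rw [map_mul, specializeConstCoeff_X_inr, if_pos hz, hz]
    simp

theorem eval_zero_specializeConstCoeff {K : Type*} [Field K] {n d : ℕ} (x : Fin n → K)
    (p : URing K n d) :
    (specializeConstCoeff d x p).eval 0 = eval x (killC K n d p) := by
  have h : (Polynomial.aeval (0 : K)).comp (specializeConstCoeff d x) =
      (aeval x).comp (killC K n d) := by
    ext (i | α)
    · simp [specializeConstCoeff, killC]
    · by_cases hα : α.1 = 0 <;> simp [specializeConstCoeff, killC, hα]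
  simpa [Polynomial.aeval_def, Polynomial.eval₂_eq_eval_map, aeval_eq_eval] using
    DFunLike.congr_fun h p

/-- Lemma 2.5. If `M = M₀ + M₁` is a uniform determinantal representation of
`p_{n,d}` of size `N` (where `M₀ = M` with all `c_α` set to zero), then `det M₀ = 0` in
`K[x₁,…,xₙ]`, and for every point `x̄ ∈ Kⁿ` the evaluated matrix `M₀(x̄)` has rank exactly
`N - 1`. -/
theorem udr_constant_part_singular (K : Type*) [Field K] (n d : ℕ) (hn : 1 ≤ n) (N : ℕ)
    (M : Matrix (Fin N) (Fin N) (URing K n d)) (hM : IsUDR K n d N M) :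
    (M.map (killC K n d)).det = 0 ∧
    ∀ xbar : Fin n → K,
      ((M.map (killC K n d)).map (eval xbar)).rank = N - 1 := by
  obtain ⟨-, hdet⟩ := hM
  have hzero : (M.map (killC K n d)).det = 0 := by
    rw [← killC_genPoly K n d, ← hdet, AlgHom.map_det]
    rfl
  refine ⟨hzero, fun xbar => ?_⟩
  have hsing : ((M.map (killC K n d)).map (eval xbar)).det = 0 := by
    rw [← map_zero (eval xbar), ← hzero, RingHom.map_det]
    rfl
  have hupper := Matrix.rank_lt_card_of_det_eq_zero hsing
  have hX : (M.map (specializeConstCoeff d xbar)).det = Polynomial.X := by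
    rw [← specializeConstCoeff_genPoly d xbar, ← hdet, AlgHom.map_det]
    rfl
  have hlower := Matrix.card_le_rank_map_eval_zero_add_one hX
  have hmap : (M.map (specializeConstCoeff d xbar)).map (Polynomial.evalRingHom 0) =
      (M.map (killC K n d)).map (eval xbar) :=
    Matrix.ext fun i j => eval_zero_specializeConstCoeff xbar (M i j)
  rw [hmap] at hlower
  rw [Fintype.card_fin] at hupper hlower
  lia
end

section
/- Let K be an infinite field of characteristic different from 2, and let N ≥ 5. Call a K-linear subspace 𝒜 ⊆ K^{N×N} singular if every matrix in 𝒜 has determinant zero, and call it inclusion-maximal singular if it is singular and is not properly contained in any singular subspace. The group GL_N(K) × GL_N(K) acts on subspaces of K^{N×N} by (g,h)·𝒜 = g𝒜h⁻¹; two subspaces are conjugate if they lie in the same orbit. Then there are infinitely many conjugacy classes of inclusion-maximal singular subspaces of K^{N×N}. -/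
namespace Matrix

theorem exists_det_add_smul_eq {R n : Type*} [CommRing R] [Fintype n] [DecidableEq n]
    (M B : Matrix n n R) (c : R) :
    ∃ q, (M + c • B).det = M.det + c * (M.adjugate * B).trace + c ^ 2 * q := by
  let f : MultilinearMap R (fun _ : n => n → R) R := detRowAlternating.toMultilinearMap
  let m : n → n → R := M
  let b : n → n → R := B
  have hlin : f.linearDeriv m (c • b) = c * (M.adjugate * B).trace := by
    rw [MultilinearMap.linearDeriv_apply, trace_mul_comm, trace, Finset.mul_sum]
    refine Finset.sum_congr rfl fun i _ => ?_
    change (M.updateRow i (c • B i)).det = _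
    rw [det_eq_sum_mul_adjugate_row _ i, diag_apply, mul_apply, Finset.mul_sum]
    refine Finset.sum_congr rfl fun j _ => ?_
    simp [adjugate_apply, mul_assoc]
  have hsum : c ^ 2 ∣ ∑ s : Finset n with 2 ≤ s.card, f (s.piecewise (c • b) m) := by
    refine Finset.dvd_sum fun s hs => ?_
    have hpw : s.piecewise (fun i => c • s.piecewise b m i) (s.piecewise b m) =
        s.piecewise (c • b) m := by
      ext i j
      by_cases hi : i ∈ s <;> simp [hi]
    have hsmul := f.map_piecewise_smul (fun _ => c) (s.piecewise b m) s
    rw [hpw] at hsmul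
    rw [hsmul, Finset.prod_const, smul_eq_mul]
    exact (pow_dvd_pow c (Finset.mem_filter.1 hs).2).mul_right _
  obtain ⟨q, hq⟩ := hsum
  refine ⟨q, ?_⟩
  rw [← hq, ← hlin]
  exact f.map_add_eq_map_add_linearDeriv_add m (c • b)

open Polynomial in
theorem trace_adjugate_mul_eq_zero {K n : Type*} [Field K] [Infinite K] [Fintype n]
    [DecidableEq n] {M B : Matrix n n K} (h : ∀ c : K, (M + c • B).det = 0) :
    (M.adjugate * B).trace = 0 := by
  have h0 : M.det = 0 := by simpa using h 0
  obtain ⟨q, hq⟩ := exists_det_add_smul_eq (C.mapMatrix M) (C.mapMatrix B) (X : K[X])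
  have hz : (C.mapMatrix M + (X : K[X]) • C.mapMatrix B).det = 0 := by
    refine Polynomial.funext fun c => ?_
    rw [← coe_evalRingHom, RingHom.map_det, map_zero, ← h c]
    congr 1
    ext i j
    simp only [coe_evalRingHom, RingHom.mapMatrix_apply, map_apply, add_apply, smul_apply,
      smul_eq_mul, eval_add, eval_mul, eval_X, eval_C]
  have ht : (C.mapMatrix (M.adjugate * B)).trace = (C (M.adjugate * B).trace : K[X]) := by
    simp only [trace, map_sum]
    rfl
  rw [hz, ← RingHom.map_adjugate, ← map_mul, ← RingHom.map_det, h0, ht] at hq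
  simpa [coeff_X_mul, pow_two, mul_assoc, coeff_zero] using (congrArg (fun p => coeff p 1) hq).symm

/-- If `u` and `w` lie in the left kernel of a matrix with nonzero adjugate, they are
proportional. -/
theorem adjugate_mul_sub_eq_zero {R n : Type*} [CommRing R] [IsDomain R] [Fintype n]
    [DecidableEq n] {M : Matrix n n R} {u w : n → R} (hu : u ᵥ* M = 0) (hw : w ᵥ* M = 0)
    (a b p : n) : M.adjugate a b * (u b * w p - w b * u p) = 0 := by
  rw [adjugate_apply, mul_eq_zero, or_iff_not_imp_left]
  intro hdet
  have hz : (u b • w - w b • u) ᵥ* M.updateRow b (Pi.single a 1) = 0 := by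
    have hM : (u b • w - w b • u) ᵥ* M = 0 := by
      rw [sub_vecMul, smul_vecMul, smul_vecMul, hu, hw]
      simp
    rw [← hM]
    ext j
    refine Finset.sum_congr rfl fun i _ => ?_
    rcases eq_or_ne i b with rfl | hi
    · simp [mul_comm]
    · simp [updateRow_apply, hi]
  exact congrFun (eq_zero_of_vecMul_eq_zero hdet hz) p

end Matrix

open Fin.NatCast in
theorem Fin.cyclic_induction {n : ℕ} {P : Fin (n + 1) → Prop} {i₀ : Fin (n + 1)} (h₀ : P i₀)
    (h : ∀ i, P i → P (i + 1)) (i : Fin (n + 1)) : P i := by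
  have hP : ∀ m : ℕ, P (i₀ + (m : Fin (n + 1))) := by
    intro m
    induction m with
    | zero => simpa using h₀
    | succ m ih => simpa [add_assoc] using h _ ih
  simpa using hP (i - i₀).val

open MvPolynomial in
theorem MvPolynomial.exists_aeval_eq_zero_of_card_lt {K σ τ : Type*} [Field K] [Fintype σ]
    [Fintype τ] (h : Fintype.card τ < Fintype.card σ) (F : σ → MvPolynomial τ K) :
    ∃ D : MvPolynomial σ K, D ≠ 0 ∧ aeval F D = 0 := by
  have hF : ¬ AlgebraicIndependent K F := by
    intro hF
    have := hF.lift_cardinalMk_le_trdeg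
    rw [MvPolynomial.trdeg_of_isDomain] at this
    simp only [Cardinal.mk_fintype, Cardinal.lift_natCast, Nat.cast_le] at this
    omega
  rw [algebraicIndependent_iff] at hF
  push Not at hF
  obtain ⟨D, hD, hD0⟩ := hF
  exact ⟨D, hD0, hD⟩

/-- The matrix of linear forms in `x` whose entry at `(i, j)` is `∑ l, a j i l * x l`. -/
def tensorMatrix {R : Type*} [CommRing R] {N : ℕ} (a : Fin N → Fin N → Fin N → R) :
    (Fin N → R) →ₗ[R] Matrix (Fin N) (Fin N) R where
  toFun x := Matrix.of fun i j => ∑ l, a j i l * x l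
  map_add' x y := by
    ext i j
    simp [mul_add, Finset.sum_add_distrib]
  map_smul' c x := by
    ext i j
    simp [Finset.mul_sum, mul_left_comm]

/-- The tensor is alternating in its last two indices. -/
def IsAltTensor {R : Type*} [CommRing R] {N : ℕ} (a : Fin N → Fin N → Fin N → R) : Prop :=
  (∀ j i l, a j i l = -a j l i) ∧ ∀ j i, a j i i = 0

/-- Indices of the independent coordinates of an alternating tensor. -/
abbrev AltIndex (N : ℕ) : Type := Fin N × (Σ q : Fin N, Fin (q : ℕ))

/-- The alternating tensor with prescribed coordinates `t (j, ⟨q, p⟩)` at `(j, q, p)`, `p < q`. -/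
def altTensor {R : Type*} [CommRing R] {N : ℕ} (t : AltIndex N → R) (j i l : Fin N) : R :=
  if h : l < i then t (j, ⟨i, ⟨l, h⟩⟩) else if h : i < l then -t (j, ⟨l, ⟨i, h⟩⟩) else 0

/-- The independent coordinates of a tensor. -/
def altCoord {R : Type*} {N : ℕ} (a : Fin N → Fin N → Fin N → R) (s : AltIndex N) : R :=
  a s.1 s.2.1 (Fin.castLE s.2.1.2.le s.2.2)

section Tensor

variable {R S : Type*} [CommRing R] [CommRing S] {N : ℕ}

theorem tensorMatrix_apply (a : Fin N → Fin N → Fin N → R) (x : Fin N → R) (i j : Fin N) :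
    tensorMatrix a x i j = ∑ l, a j i l * x l := rfl

theorem mapMatrix_tensorMatrix (f : R →+* S) (a : Fin N → Fin N → Fin N → R) (x : Fin N → R) :
    f.mapMatrix (tensorMatrix a x) = tensorMatrix (fun j i l => f (a j i l)) (fun l => f (x l)) := by
  ext i j
  simp [tensorMatrix_apply]

theorem isAltTensor_altTensor (t : AltIndex N → R) : IsAltTensor (altTensor t) := by
  refine ⟨fun j i l => ?_, fun j i => by simp [altTensor]⟩
  rcases lt_trichotomy i l with h | rfl | h
  · simp [altTensor, h, h.not_gt]
  · simp [altTensor]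
  · simp [altTensor, h, h.not_gt]

theorem map_altTensor (f : R →+* S) (t : AltIndex N → R) (j i l : Fin N) :
    f (altTensor t j i l) = altTensor (fun s => f (t s)) j i l := by
  unfold altTensor
  split_ifs <;> simp

theorem altTensor_altCoord {a : Fin N → Fin N → Fin N → R} (ha : IsAltTensor a) :
    altTensor (altCoord a) = a := by
  ext j i l
  rcases lt_trichotomy i l with h | rfl | h
  · rw [ha.1]
    simp [altTensor, h, h.not_gt, altCoord]
  · simp [altTensor, ha.2]
  · simp [altTensor, h, altCoord]

theorem altCoord_altTensor (t : AltIndex N → R) : altCoord (altTensor t) = t := by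
  ext ⟨j, q, p⟩
  have : Fin.castLE q.2.le p < q := p.2
  simp [altCoord, altTensor, this]

theorem vecMul_tensorMatrix_self {a : Fin N → Fin N → Fin N → R} (ha : IsAltTensor a)
    (x : Fin N → R) : Matrix.vecMul x (tensorMatrix a x) = 0 := by
  ext j
  simp only [Matrix.vecMul, dotProduct, tensorMatrix_apply, Finset.mul_sum, Pi.zero_apply]
  rw [← Finset.sum_product' (f := fun i l => x i * (a j i l * x l))]
  refine Finset.sum_involution (fun p _ => p.swap) (fun p _ => ?_) (fun p _ hp h => hp ?_)
    (fun _ _ => Finset.mem_univ _) (fun _ _ => rfl)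
  · simp only [Prod.fst_swap, Prod.snd_swap]
    rw [ha.1 j p.2 p.1]
    ring
  · have : p.2 = p.1 := congrArg Prod.fst h
    rw [this, ha.2]
    ring

theorem det_tensorMatrix [IsDomain R] [NeZero N] {a : Fin N → Fin N → Fin N → R}
    (ha : IsAltTensor a) (x : Fin N → R) : (tensorMatrix a x).det = 0 := by
  rcases eq_or_ne x 0 with rfl | hx
  · simp [Matrix.det_zero]
  · exact Matrix.exists_vecMul_eq_zero_iff.1 ⟨x, hx, vecMul_tensorMatrix_self ha x⟩

end Tensor

/-- A tensor `a` is critical if its matrix space contains every matrix orthogonal, for the trace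
form, to all adjugates of its members. -/
def IsCriticalTensor {K : Type*} [Field K] {N : ℕ} (a : Fin N → Fin N → Fin N → K) : Prop :=
  ∀ B : Matrix (Fin N) (Fin N) K,
    (∀ x, ((tensorMatrix a x).adjugate * B).trace = 0) → B ∈ LinearMap.range (tensorMatrix a)

section Critical

variable {K : Type*} [Field K] {N : ℕ}

theorem IsCriticalTensor.eq_of_le [Infinite K] {a : Fin N → Fin N → Fin N → K}
    (hc : IsCriticalTensor a)
    {B : Submodule K (Matrix (Fin N) (Fin N) K)} (hB : ∀ X ∈ B, X.det = 0)
    (hle : LinearMap.range (tensorMatrix a) ≤ B) : LinearMap.range (tensorMatrix a) = B := by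
  refine le_antisymm hle fun Y hY => hc Y fun x => ?_
  exact Matrix.trace_adjugate_mul_eq_zero fun c =>
    hB _ (B.add_mem (hle ⟨x, rfl⟩) (B.smul_mem c hY))

theorem IsCriticalTensor.exists_adjugate_ne_zero [NeZero N] {a : Fin N → Fin N → Fin N → K}
    (hc : IsCriticalTensor a) (ha : IsAltTensor a) :
    ∃ x i j, (tensorMatrix a x).adjugate i j ≠ 0 := by
  by_contra! h
  obtain ⟨y, hy⟩ := hc 1 fun x => by
    have : (tensorMatrix a x).adjugate = 0 := by
      ext i j
      exact h x i j
    simp [this]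
  simpa [hy] using det_tensorMatrix ha y

open MvPolynomial in
/-- A linear map sending each `x` into the left kernel of `tensorMatrix a x` is a homothety. -/
theorem IsCriticalTensor.exists_eq_smul [Infinite K] [NeZero N] {a : Fin N → Fin N → Fin N → K}
    (hc : IsCriticalTensor a) (ha : IsAltTensor a) (v : (Fin N → K) →ₗ[K] (Fin N → K))
    (hv : ∀ x, Matrix.vecMul (v x) (tensorMatrix a x) = 0) : ∃ c : K, ∀ x, v x = c • x := by
  obtain ⟨x₀, i, b, hx₀⟩ := hc.exists_adjugate_ne_zero ha
  let V := LinearMap.toMatrix' v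
  have hV : ∀ x p, v x p = ∑ l, V p l * x l := fun x p => by
    conv_lhs => rw [← Matrix.toLin'_toMatrix' v]
    rfl
  have hprop : ∀ p x, v x b * x p = x b * v x p := by
    intro p
    let P : MvPolynomial (Fin N) K :=
      (tensorMatrix (fun j i l => C (a j i l)) (X : Fin N → MvPolynomial (Fin N) K)).adjugate i b
    have hP : ∀ x, eval x P = (tensorMatrix a x).adjugate i b := by
      intro x
      have := congrFun₂ ((eval x).map_adjugate
        (tensorMatrix (fun j i l => C (a j i l)) (X : Fin N → MvPolynomial (Fin N) K))) i b
      rw [mapMatrix_tensorMatrix] at this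
      simpa using this
    let Q : MvPolynomial (Fin N) K :=
      (∑ l, C (V b l) * X l) * X p - X b * ∑ l, C (V p l) * X l
    have hQ : ∀ x, eval x Q = v x b * x p - x b * v x p := by
      intro x
      simp [Q, hV]
    have hPQ : P * Q = 0 := by
      refine MvPolynomial.funext fun x => ?_
      rw [map_mul, hP, hQ, map_zero]
      exact Matrix.adjugate_mul_sub_eq_zero (hv x) (vecMul_tensorMatrix_self ha x) i b p
    have hP0 : P ≠ 0 := fun h => hx₀ (by rw [← hP, h, map_zero])
    intro x
    rw [← sub_eq_zero, ← hQ, (mul_eq_zero.1 hPQ).resolve_left hP0, map_zero]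
  have hb : ∀ p, p ≠ b → v (Pi.single p 1) b = 0 := fun p hp => by
    simpa [hp.symm] using hprop p (Pi.single p 1)
  have hb' : ∀ p, p ≠ b → v (Pi.single b 1) p = 0 := fun p hp => by
    simpa [hp] using (hprop p (Pi.single b 1)).symm
  refine ⟨v (Pi.single b 1) b, ?_⟩
  suffices h : v = v (Pi.single b 1) b • LinearMap.id from fun x => by rw [h]; simp
  refine LinearMap.pi_ext' fun q => LinearMap.ext_ring ?_
  ext p
  simp only [LinearMap.comp_apply, LinearMap.single_apply, LinearMap.smul_apply, LinearMap.id_apply,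
    Pi.smul_apply, smul_eq_mul]
  rcases eq_or_ne q b with rfl | hq
  · rcases eq_or_ne p q with rfl | hp
    · simp
    · simp [hb' p hp, hp]
  · have hs := hprop p (Pi.single b 1 + Pi.single q 1)
    rcases eq_or_ne p b with rfl | hp
    · simp [hb q hq, hq.symm]
    · simp only [map_add, Pi.add_apply, hb q hq, hb' p hp, Pi.single_apply, hq.symm, hp, if_true,
        if_false, zero_add, add_zero, one_mul] at hs
      simpa [Pi.single_apply] using hs.symm

/-- If the matrix space of a critical alternating tensor is contained in an equivalent copy of
another one, then the two tensors are related by a substitution with `2 N ^ 2` parameters. -/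
theorem IsCriticalTensor.exists_eq_mul [Infinite K] [NeZero N] {a a' : Fin N → Fin N → Fin N → K}
    (hc : IsCriticalTensor a) (ha : IsAltTensor a) (ha' : IsAltTensor a')
    (g : (Matrix (Fin N) (Fin N) K)ˣ) (h : Matrix (Fin N) (Fin N) K)
    (hsub : ∀ x, ∃ y, tensorMatrix a x = g.val * tensorMatrix a' y * h) :
    ∃ h' : Matrix (Fin N) (Fin N) K, ∀ x,
      tensorMatrix a x = g.val * tensorMatrix a' (Matrix.vecMul x g.val) * h' := by
  choose y hy using fun l : Fin N => hsub (Pi.single l 1)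
  let c : (Fin N → K) →ₗ[K] (Fin N → K) := (Pi.basisFun K (Fin N)).constr K y
  have hcx : ∀ x, tensorMatrix a x = g.val * tensorMatrix a' (c x) * h := by
    let F : (Fin N → K) →ₗ[K] Matrix (Fin N) (Fin N) K :=
      (LinearMap.mulLeft K g.val ∘ₗ LinearMap.mulRight K h) ∘ₗ tensorMatrix a' ∘ₗ c
    suffices hF : tensorMatrix a = F from fun x => by
      rw [hF]
      simp [F, mul_assoc]
    refine (Pi.basisFun K (Fin N)).ext fun l => ?_
    rw [Pi.basisFun_apply, hy]
    have : c (Pi.single l 1) = y l := by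
      rw [← Pi.basisFun_apply, Module.Basis.constr_basis]
    simp [F, this, mul_assoc]
  let v : (Fin N → K) →ₗ[K] (Fin N → K) := Matrix.vecMulLinear (g⁻¹).val ∘ₗ c
  have hvg : ∀ x, Matrix.vecMul (v x) g.val = c x := fun x => by
    simp [v, Matrix.vecMul_vecMul]
  obtain ⟨r, hr⟩ := hc.exists_eq_smul ha v fun x => by
    rw [hcx, ← Matrix.vecMul_vecMul, ← Matrix.vecMul_vecMul, hvg, vecMul_tensorMatrix_self ha',
      Matrix.zero_vecMul]
  refine ⟨r • h, fun x => ?_⟩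
  rw [hcx, ← hvg, hr, Matrix.smul_vecMul, map_smul]
  simp

end Critical

section Openness

/-- Positions off the main diagonal. -/
abbrev OffDiag (N : ℕ) : Type := {p : Fin N × Fin N // p.1 ≠ p.2}

open MvPolynomial in
/-- Selected coefficients of the adjugate of the generic member of the matrix space. -/
noncomputable def adjugateCoeff {R : Type*} [CommRing R] {N : ℕ} (m : OffDiag N → Fin N →₀ ℕ)
    (a : Fin N → Fin N → Fin N → R) : Matrix (OffDiag N) (OffDiag N) R :=
  Matrix.of fun p q => coeff (m p)
    ((tensorMatrix (fun j i l => (C (a j i l) : MvPolynomial (Fin N) R)) X).adjugate q.1.2 q.1.1)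

/-- The linear forms on the main diagonal of `tensorMatrix a`. -/
def diagForms {R : Type*} {N : ℕ} (a : Fin N → Fin N → Fin N → R) : Matrix (Fin N) (Fin N) R :=
  Matrix.of fun j l => a j j l

open MvPolynomial in
theorem mapMatrix_adjugateCoeff {R S : Type*} [CommRing R] [CommRing S] {N : ℕ} (f : R →+* S)
    (m : OffDiag N → Fin N →₀ ℕ) (a : Fin N → Fin N → Fin N → R) :
    f.mapMatrix (adjugateCoeff m a) = adjugateCoeff m (fun j i l => f (a j i l)) := by
  ext p q
  have := congrFun₂ ((MvPolynomial.map f).map_adjugate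
    (tensorMatrix (fun j i l => (C (a j i l) : MvPolynomial (Fin N) R)) X)) q.1.2 q.1.1
  rw [mapMatrix_tensorMatrix] at this
  simp only [map_C, map_X] at this
  simp only [RingHom.mapMatrix_apply, Matrix.map_apply, adjugateCoeff, Matrix.of_apply]
  rw [← coeff_map]
  exact congrArg _ this

open MvPolynomial in
theorem isCriticalTensor_of_det_ne_zero {K : Type*} [Field K] [Infinite K] {N : ℕ} [NeZero N]
    {a : Fin N → Fin N → Fin N → K} (ha : IsAltTensor a) (m : OffDiag N → Fin N →₀ ℕ)
    (hm : (adjugateCoeff m a).det ≠ 0) (hd : (diagForms a).det ≠ 0) : IsCriticalTensor a := by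
  intro B hB
  let A : Matrix (Fin N) (Fin N) (MvPolynomial (Fin N) K) :=
    (tensorMatrix (fun j i l => C (a j i l)) X).adjugate
  have hA : ∀ x, (eval x).mapMatrix A = (tensorMatrix a x).adjugate := by
    intro x
    rw [RingHom.map_adjugate, mapMatrix_tensorMatrix]
    simp
  let y : Fin N → K := Matrix.mulVec (diagForms a)⁻¹ fun j => B j j
  have hy : ∀ j, tensorMatrix a y j j = B j j := fun j => by
    have : Matrix.mulVec (diagForms a) y = fun j => B j j := by
      rw [Matrix.mulVec_mulVec, Matrix.mul_nonsing_inv _ (isUnit_iff_ne_zero.2 hd),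
        Matrix.one_mulVec]
    exact congrFun this j
  let D := B - tensorMatrix a y
  have hDdiag : ∀ j, D j j = 0 := fun j => by simp [D, hy]
  have hD : ∀ x, ((tensorMatrix a x).adjugate * D).trace = 0 := fun x => by
    have : ((tensorMatrix a x).adjugate * tensorMatrix a y).trace = 0 :=
      Matrix.trace_adjugate_mul_eq_zero fun c => by
        rw [← map_smul, ← map_add, det_tensorMatrix ha]
    rw [Matrix.mul_sub, Matrix.trace_sub, hB, this, sub_zero]
  have hpoly : ∑ q : OffDiag N, C (D q.1.1 q.1.2) * A q.1.2 q.1.1 = 0 := by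
    refine MvPolynomial.funext fun x => ?_
    rw [map_zero, ← hD x, ← hA, Matrix.trace_mul_comm]
    simp only [map_sum, map_mul, eval_C, Matrix.trace, Matrix.diag_apply, Matrix.mul_apply]
    rw [← Finset.sum_product' (f := fun i j => D i j * (eval x).mapMatrix A j i),
      Finset.univ_product_univ]
    let f : Fin N × Fin N → K := fun p => D p.1 p.2 * (eval x).mapMatrix A p.2 p.1
    change ∑ q : OffDiag N, f q = ∑ p, f p
    rw [← Finset.sum_subtype (Finset.univ.filter fun p : Fin N × Fin N => p.1 ≠ p.2)
      (by simp) f]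
    refine Finset.sum_filter_of_ne fun p _ hp hpp => hp ?_
    simp only [f]
    rw [hpp, hDdiag, zero_mul]
  have hvec : Matrix.mulVec (adjugateCoeff m a) (fun q => D q.1.1 q.1.2) = 0 := by
    ext p
    have hcoeff := congrArg (coeff (m p)) hpoly
    simp only [coeff_sum, coeff_C_mul, coeff_zero] at hcoeff
    refine Eq.trans ?_ hcoeff
    exact Finset.sum_congr rfl fun q _ => mul_comm _ _
  have hzero := Matrix.eq_zero_of_mulVec_eq_zero hm hvec
  have hD0 : D = 0 := by
    ext i j
    rcases eq_or_ne i j with rfl | hij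
    · exact hDdiag i
    · exact congrFun hzero ⟨(i, j), hij⟩
  exact ⟨y, (sub_eq_zero.1 hD0).symm⟩

end Openness

section Cycle

/-- The tensor whose matrix space is spanned by the weighted incidence matrices of a cycle. -/
def cycleTensor (R : Type*) [CommRing R] (n : ℕ) (j i l : Fin (n + 1)) : R :=
  (if i = j ∧ l = j + 1 then 1 else 0) - (if i = j + 1 ∧ l = j then 1 else 0)

theorem isAltTensor_cycleTensor (R : Type*) [CommRing R] (n : ℕ) :
    IsAltTensor (cycleTensor R n) := by
  refine ⟨fun j i l => ?_, fun j i => ?_⟩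
  · simp only [cycleTensor, neg_sub, and_comm]
  · simp only [cycleTensor, and_comm, sub_self]

theorem map_cycleTensor {R S : Type*} [CommRing R] [CommRing S] (f : R →+* S) (n : ℕ)
    (j i l : Fin (n + 1)) : f (cycleTensor R n j i l) = cycleTensor S n j i l := by
  unfold cycleTensor
  rw [map_sub]
  congr 1 <;> split_ifs <;> simp

theorem tensorMatrix_cycleTensor {R : Type*} [CommRing R] (n : ℕ) (x : Fin (n + 1) → R)
    (i j : Fin (n + 1)) : tensorMatrix (cycleTensor R n) x i j =
      (if i = j then x (j + 1) else 0) - (if i = j + 1 then x j else 0) := by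
  simp only [tensorMatrix_apply, cycleTensor, sub_mul, Finset.sum_sub_distrib, ite_and]
  congr 1 <;> split_ifs <;> simp

theorem det_diagForms_cycleTensor {K : Type*} [Field K] {n : ℕ} (hn : 1 ≤ n) :
    (diagForms (cycleTensor K n)).det ≠ 0 := by
  have : NeZero n := ⟨by omega⟩
  intro h
  obtain ⟨v, hv, hz⟩ := Matrix.exists_mulVec_eq_zero_iff.2 h
  refine hv (funext fun i => ?_)
  have := congrFun hz (i - 1)
  have h1 : (1 : Fin (n + 1)) ≠ 0 := by
    simp
  simpa [Matrix.mulVec, dotProduct, diagForms, cycleTensor, h1, sub_eq_iff_eq_add] using this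

variable {R : Type*} [CommRing R] [IsDomain R] {n : ℕ}

theorem adjugate_cycleTensor_mul {x : Fin (n + 1) → R} (hx : ∀ i, x i ≠ 0)
    (i j : Fin (n + 1)) : (tensorMatrix (cycleTensor R n) x).adjugate j i * (x j * x (j + 1)) =
      x i * ∏ l, x l := by
  set M := tensorMatrix (cycleTensor R n) x with hM
  have hdet : M.det = 0 := det_tensorMatrix (isAltTensor_cycleTensor R n) x
  have hrow : ∀ i j, M.adjugate (j + 1) i * x (j + 1 + 1) = x j * M.adjugate j i := by
    intro i j
    have := congrFun₂ M.mul_adjugate (j + 1) i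
    rw [hdet, zero_smul] at this
    simpa [Matrix.mul_apply, hM, tensorMatrix_cycleTensor, sub_mul, sub_eq_zero, mul_comm]
      using this
  have hcol : ∀ i j, M.adjugate j (i + 1) * x i = M.adjugate j i * x (i + 1) := by
    intro i j
    have := congrFun₂ M.adjugate_mul j i
    rw [hdet, zero_smul] at this
    refine (sub_eq_zero.1 ?_).symm
    simpa [Matrix.mul_apply, hM, tensorMatrix_cycleTensor, mul_sub] using this
  have hlast : M.adjugate (Fin.last n) (Fin.last n) = ∏ i : Fin n, x i.succ := by
    rw [Matrix.adjugate_fin_succ_eq_det_submatrix, Matrix.det_of_isLowerTriangular]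
    · have hne : ∀ i : Fin n, i.castSucc ≠ i.succ := fun i => i.castSucc_lt_succ.ne
      simp [hM, tensorMatrix_cycleTensor, hne]
    · intro i j hij
      have hlt : i < j := hij
      have hne : i.castSucc ≠ j.succ := (Fin.castSucc_lt_succ_iff.2 hlt.le).ne
      simp [hM, tensorMatrix_cycleTensor, hlt.ne, hne]
  induction i using Fin.cyclic_induction (i₀ := Fin.last n) with
  | h₀ =>
    induction j using Fin.cyclic_induction (i₀ := Fin.last n) with
    | h₀ =>
      rw [hlast, Fin.prod_univ_succ x, Fin.last_add_one]
      ring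
    | h j ih => rw [← ih]; linear_combination x (j + 1) * hrow (Fin.last n) j
  | h i ih =>
    refine mul_right_cancel₀ (hx i) ?_
    linear_combination x (i + 1) * ih + (x j * x (j + 1)) * hcol i j

/-- The exponents of the entries of the adjugate for the cycle. -/
noncomputable def cycleExponent (n : ℕ) (p : OffDiag (n + 1)) : Fin (n + 1) →₀ ℕ :=
  Finsupp.single p.1.1 1 +
    ∑ l with l ≠ p.1.2 ∧ l ≠ p.1.2 + 1, Finsupp.single l 1

theorem cycleExponent_injective (hn : 2 ≤ n) : Function.Injective (cycleExponent n) := by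
  have hval : ∀ p l, cycleExponent n p l =
      (if p.1.1 = l then 1 else 0) + if l ≠ p.1.2 ∧ l ≠ p.1.2 + 1 then 1 else 0 := by
    intro p l
    simp [cycleExponent, Finsupp.single_apply, Finset.sum_ite_eq']
  have hmem : ∀ p q, cycleExponent n p = cycleExponent n q →
      q.1.2 = p.1.2 ∨ q.1.2 = p.1.2 + 1 := by
    intro p q h
    have h1 := DFunLike.congr_fun h q.1.2
    rw [hval, hval, if_neg q.2] at h1
    by_contra! h2
    simp [h2] at h1
  intro p q h
  have hpq : p.1.2 = q.1.2 := by
    rcases hmem p q h with h1 | h1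
    · exact h1.symm
    rcases hmem q p h.symm with h2 | h2
    · exact h2
    rw [h1, add_assoc, left_eq_add] at h2
    have hval := congrArg Fin.val h2
    rw [Fin.val_add, Fin.val_one', Nat.mod_eq_of_lt (show 1 < n + 1 by omega),
      Nat.mod_eq_of_lt (by omega)] at hval
    simp at hval
  have hfst : p.1.1 = q.1.1 := by
    rw [cycleExponent, cycleExponent, hpq, add_left_inj] at h
    exact (Finsupp.single_left_inj one_ne_zero).1 h
  exact Subtype.ext (Prod.ext hfst hpq)

open MvPolynomial in
theorem adjugateCoeff_cycleTensor (hn : 2 ≤ n) :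
    adjugateCoeff (cycleExponent n) (cycleTensor R n) = 1 := by
  have h1 : (1 : Fin (n + 1)) ≠ 0 := by
    simp only [ne_eq, Fin.one_eq_zero_iff]
    omega
  ext p q
  have hadj : (tensorMatrix (cycleTensor (MvPolynomial (Fin (n + 1)) R) n) X).adjugate
      q.1.2 q.1.1 = monomial (cycleExponent n q) 1 := by
    refine mul_right_cancel₀ (mul_ne_zero (X_ne_zero q.1.2) (X_ne_zero (q.1.2 + 1))) ?_
    rw [adjugate_cycleTensor_mul X_ne_zero]
    have hmon : (monomial (cycleExponent n q) 1 : MvPolynomial (Fin (n + 1)) R) =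
        X q.1.1 * ∏ l with l ≠ q.1.2 ∧ l ≠ q.1.2 + 1, X l := by
      rw [cycleExponent, ← one_mul (1 : R), ← monomial_mul, monomial_sum_one]
      rfl
    rw [hmon, mul_assoc, ← Finset.prod_filter_mul_prod_filter_not Finset.univ
      (fun l => l ≠ q.1.2 ∧ l ≠ q.1.2 + 1)]
    congr 2
    have : (Finset.univ.filter fun l => ¬ (l ≠ q.1.2 ∧ l ≠ q.1.2 + 1)) = {q.1.2, q.1.2 + 1} := by
      ext l
      simp only [Finset.mem_filter, Finset.mem_univ, true_and, Finset.mem_insert,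
        Finset.mem_singleton]
      tauto
    rw [this, Finset.prod_pair (by simpa using h1)]
  simp only [adjugateCoeff, Matrix.of_apply, Matrix.one_apply]
  have hC : (fun j i l => (C (cycleTensor R n j i l) : MvPolynomial (Fin (n + 1)) R)) =
      cycleTensor _ n := by
    ext1 j; ext1 i; ext1 l
    exact map_cycleTensor C n j i l
  rw [hC, hadj, coeff_monomial]
  simp only [(cycleExponent_injective hn).eq_iff, eq_comm]

end Cycle

section Orbit

/-- The coordinates of the tensor obtained from `a` by the substitution `x ↦ x ᵥ* g` together with
left multiplication by `g` and right multiplication by `h`. -/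
def orbitCoord {R : Type*} [CommRing R] {N : ℕ} (a : Fin N → Fin N → Fin N → R)
    (g h : Matrix (Fin N) (Fin N) R) (s : AltIndex N) : R :=
  (g * tensorMatrix a (g (Fin.castLE s.2.1.2.le s.2.2)) * h) s.2.1 s.1

theorem map_orbitCoord {R S : Type*} [CommRing R] [CommRing S] {N : ℕ} (f : R →+* S)
    (a : Fin N → Fin N → Fin N → R) (g h : Matrix (Fin N) (Fin N) R) (s : AltIndex N) :
    f (orbitCoord a g h s) =
      orbitCoord (fun j i l => f (a j i l)) (f.mapMatrix g) (f.mapMatrix h) s := by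
  have key : ∀ x : Fin N → R, f.mapMatrix (g * tensorMatrix a x * h) =
      f.mapMatrix g * tensorMatrix (fun j i l => f (a j i l)) (fun l => f (x l)) *
        f.mapMatrix h := fun x => by
    rw [map_mul, map_mul, mapMatrix_tensorMatrix]
  exact congrFun₂ (key (g (Fin.castLE s.2.1.2.le s.2.2))) s.2.1 s.1

theorem orbitCoord_smul {K : Type*} [Field K] {N : ℕ} (a : Fin N → Fin N → Fin N → K)
    (g h : Matrix (Fin N) (Fin N) K) {c : K} (hc : c ≠ 0) :
    orbitCoord a (c⁻¹ • g) (c ^ 2 • h) = orbitCoord a g h := by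
  ext s
  have hrow : ∀ p, (c⁻¹ • g) p = c⁻¹ • g p := fun _ => rfl
  simp only [orbitCoord, hrow, map_smul, Matrix.smul_mul, Matrix.mul_smul, smul_smul]
  rw [show c ^ 2 * (c⁻¹ * c⁻¹) = 1 by field_simp, one_smul]

theorem altCoord_eq_orbitCoord {R : Type*} [CommRing R] {N : ℕ}
    {a a' : Fin N → Fin N → Fin N → R} {g h : Matrix (Fin N) (Fin N) R}
    (H : ∀ x, tensorMatrix a x = g * tensorMatrix a' (Matrix.vecMul x g) * h) :
    altCoord a = orbitCoord a' g h := by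
  ext s
  have := congrFun₂ (H (Pi.single (Fin.castLE s.2.1.2.le s.2.2) 1)) s.2.1 s.1
  rw [Matrix.single_one_vecMul] at this
  simp only [tensorMatrix_apply, Pi.single_apply, mul_ite, mul_one, mul_zero,
    Finset.sum_ite_eq', Finset.mem_univ, if_true] at this
  exact this

theorem card_altIndex_mul_two (N : ℕ) : Fintype.card (AltIndex N) * 2 = N * (N * (N - 1)) := by
  rw [Fintype.card_prod, Fintype.card_sigma]
  simp only [Fintype.card_fin]
  rw [Fin.sum_univ_eq_sum_range (fun q => q) N, mul_assoc, Finset.sum_range_id_mul_two]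

open MvPolynomial in
/-- The coordinate vectors of the tensors equivalent to `a` lie on a hypersurface. -/
theorem exists_eval_orbitCoord_eq_zero {K : Type*} [Field K] {N : ℕ} (hN : 5 ≤ N)
    (a : Fin N → Fin N → Fin N → K) :
    ∃ D : MvPolynomial (AltIndex N) K, D ≠ 0 ∧
      ∀ g h : Matrix (Fin N) (Fin N) K, g ≠ 0 → eval (orbitCoord a g h) D = 0 := by
  have key : ∀ e : Fin N × Fin N, ∃ D : MvPolynomial (AltIndex N) K, D ≠ 0 ∧
      ∀ g h : Matrix (Fin N) (Fin N) K, g e.1 e.2 ≠ 0 → eval (orbitCoord a g h) D = 0 := by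
    intro e
    let τ := {p : Fin N × Fin N // p ≠ e} ⊕ (Fin N × Fin N)
    have hcard : Fintype.card τ < Fintype.card (AltIndex N) := by
      have h1 : Fintype.card {p : Fin N × Fin N // p ≠ e} < Fintype.card (Fin N × Fin N) :=
        Fintype.card_subtype_lt (x := e) (by simp)
      have h2 := card_altIndex_mul_two N
      have h3 : N * (N * 4) ≤ N * (N * (N - 1)) :=
        Nat.mul_le_mul_left _ (Nat.mul_le_mul_left _ (by omega))
      rw [Fintype.card_prod, Fintype.card_fin] at h1
      rw [Fintype.card_sum, Fintype.card_prod, Fintype.card_fin]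
      nlinarith
    let G : Matrix (Fin N) (Fin N) (MvPolynomial τ K) := Matrix.of fun i j =>
      if h : (i, j) ≠ e then X (Sum.inl ⟨(i, j), h⟩) else 1
    let H : Matrix (Fin N) (Fin N) (MvPolynomial τ K) := Matrix.of fun i j => X (Sum.inr (i, j))
    obtain ⟨D, hD, hD0⟩ := MvPolynomial.exists_aeval_eq_zero_of_card_lt hcard
      (orbitCoord (fun j i l => C (a j i l)) G H)
    refine ⟨D, hD, fun g h hg => ?_⟩
    let w : τ → K := Sum.elim (fun p => (g e.1 e.2)⁻¹ * g p.1.1 p.1.2)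
      fun p => g e.1 e.2 ^ 2 * h p.1 p.2
    have hG : (eval w).mapMatrix G = (g e.1 e.2)⁻¹ • g := by
      ext i j
      by_cases hij : (i, j) = e
      · subst hij
        simp [G, hg]
      · simp [G, hij, w]
    have hH : (eval w).mapMatrix H = g e.1 e.2 ^ 2 • h := by
      ext i j
      simp [H, w]
    have hw : (fun s => eval w (orbitCoord (fun j i l => C (a j i l)) G H s)) =
        orbitCoord a g h := by
      rw [← orbitCoord_smul a g h hg, ← hG, ← hH]
      ext s
      rw [map_orbitCoord]
      simp only [eval_C]
    have := congrArg (eval w) hD0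
    rw [map_zero, aeval_def, eval_eval₂] at this
    have hid : (eval w).comp (algebraMap K (MvPolynomial τ K)) = RingHom.id K := by
      ext; simp
    rwa [hid, hw] at this
  choose D hD hD0 using key
  refine ⟨∏ e, D e, Finset.prod_ne_zero_iff.2 fun e _ => hD e, fun g h hg => ?_⟩
  obtain ⟨i, j, hij⟩ : ∃ i j, g i j ≠ 0 := by
    by_contra! h0
    exact hg (Matrix.ext h0)
  rw [map_prod]
  exact Finset.prod_eq_zero (Finset.mem_univ (i, j)) (hD0 (i, j) g h hij)

end Orbit

open MvPolynomial in
/-- Criticality is a Zariski-open condition satisfied by the cycle tensor. -/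
theorem exists_forall_isCriticalTensor (K : Type*) [Field K] [Infinite K] {N : ℕ} (hN : 3 ≤ N) :
    ∃ E : MvPolynomial (AltIndex N) K, E ≠ 0 ∧
      ∀ t, eval t E ≠ 0 → IsCriticalTensor (altTensor t) := by
  obtain ⟨n, rfl⟩ : ∃ n, N = n + 1 := ⟨N - 1, by omega⟩
  let a : Fin (n + 1) → Fin (n + 1) → Fin (n + 1) → MvPolynomial (AltIndex (n + 1)) K := altTensor X
  have ha : ∀ t, (fun j i l => eval t (a j i l)) = altTensor t := fun t => by
    ext j i l
    simp only [a, map_altTensor, eval_X]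
  have h1 : ∀ t, eval t (adjugateCoeff (cycleExponent n) a).det =
      (adjugateCoeff (cycleExponent n) (altTensor t)).det := fun t => by
    rw [RingHom.map_det, mapMatrix_adjugateCoeff, ha]
  have h2 : ∀ t, eval t (diagForms a).det = (diagForms (altTensor t)).det := fun t => by
    rw [RingHom.map_det, ← ha]
    rfl
  refine ⟨(adjugateCoeff (cycleExponent n) a).det * (diagForms a).det, fun h => ?_, fun t ht => ?_⟩
  · have := congrArg (eval (altCoord (cycleTensor K n))) h
    rw [map_mul, h1, h2, altTensor_altCoord (isAltTensor_cycleTensor K n),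
      adjugateCoeff_cycleTensor (by omega), Matrix.det_one, one_mul, map_zero] at this
    exact det_diagForms_cycleTensor (by omega) this
  · rw [map_mul, h1, h2] at ht
    exact isCriticalTensor_of_det_ne_zero (isAltTensor_altTensor t) _ (left_ne_zero_of_mul ht)
      (right_ne_zero_of_mul ht)

/-- Theorem 3.3. Over an infinite field `K` of characteristic different
from 2, for `N ≥ 5` there are infinitely many conjugacy classes (under the action
`(g,h)·𝒜 = g𝒜h⁻¹` of `GL_N(K) × GL_N(K)`) of inclusion-maximal singular subspaces of
`K^{N×N}`: no finite set of subspaces meets every conjugacy class of inclusion-maximal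
singular subspaces. -/
theorem infinitely_many_maximal_singular_classes
    (K : Type*) [Field K] [Infinite K] (h2 : ringChar K ≠ 2) (N : ℕ) (hN : 5 ≤ N) :
    ¬ ∃ T : Finset (Submodule K (Matrix (Fin N) (Fin N) K)),
        ∀ A : Submodule K (Matrix (Fin N) (Fin N) K),
          ((∀ X ∈ A, Matrix.det X = 0) ∧
            ∀ B : Submodule K (Matrix (Fin N) (Fin N) K),
              (∀ X ∈ B, Matrix.det X = 0) → A ≤ B → A = B) →
          ∃ B ∈ T, ∃ g h : (Matrix (Fin N) (Fin N) K)ˣ,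
            B = Submodule.map
              ((LinearMap.mulLeft K ((g : Matrix (Fin N) (Fin N) K))).comp
                (LinearMap.mulRight K
                  (((h⁻¹ : (Matrix (Fin N) (Fin N) K)ˣ) : Matrix (Fin N) (Fin N) K)))) A := by
  rintro ⟨T, hT⟩
  have : NeZero N := ⟨by omega⟩
  let Conj (t : AltIndex N → K) (B : Submodule K (Matrix (Fin N) (Fin N) K)) : Prop :=
    ∃ g h : (Matrix (Fin N) (Fin N) K)ˣ, B = Submodule.map
      ((LinearMap.mulLeft K g.val).comp (LinearMap.mulRight K (h⁻¹).val))
      (LinearMap.range (tensorMatrix (altTensor t)))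
  obtain ⟨E, hE, hcrit⟩ := exists_forall_isCriticalTensor K (show 3 ≤ N by omega)
  have hcover : ∀ t, MvPolynomial.eval t E ≠ 0 → ∃ B ∈ T, Conj t B := fun t ht => by
    refine hT _ ⟨?_, fun B hB hle => (hcrit t ht).eq_of_le hB hle⟩
    rintro _ ⟨x, rfl⟩
    exact det_tensorMatrix (isAltTensor_altTensor t) x
  have hpoly : ∀ B, ∃ D : MvPolynomial (AltIndex N) K, D ≠ 0 ∧
      ∀ t, MvPolynomial.eval t E ≠ 0 → Conj t B → MvPolynomial.eval t D = 0 := by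
    intro B
    by_cases hB : ∃ t₀, Conj t₀ B
    · obtain ⟨t₀, g₀, h₀, hB₀⟩ := hB
      obtain ⟨D, hD, hD0⟩ := exists_eval_orbitCoord_eq_zero hN (altTensor t₀)
      refine ⟨D, hD, ?_⟩
      rintro t ht ⟨g, h, hBt⟩
      obtain ⟨h', hh'⟩ := (hcrit t ht).exists_eq_mul (isAltTensor_altTensor t)
        (isAltTensor_altTensor t₀) (g⁻¹ * g₀) ((h₀⁻¹).val * h.val) fun x => by
          have hmem : g.val * (tensorMatrix (altTensor t) x * (h⁻¹).val) ∈ B := by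
            rw [hBt]
            exact ⟨_, ⟨x, rfl⟩, rfl⟩
          rw [hB₀] at hmem
          obtain ⟨_, ⟨y, rfl⟩, hy⟩ := hmem
          refine ⟨y, ?_⟩
          have hy' : g₀.val * (tensorMatrix (altTensor t₀) y * (h₀⁻¹).val) =
            g.val * (tensorMatrix (altTensor t) x * (h⁻¹).val) := hy
          calc _ = (g⁻¹).val * (g.val * (tensorMatrix (altTensor t) x * (h⁻¹).val)) * h.val := by
                simp [mul_assoc]
            _ = _ := by
                rw [← hy']
                simp only [Units.val_mul, mul_assoc]
      rw [← altCoord_altTensor t, altCoord_eq_orbitCoord hh']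
      exact hD0 _ _ (Units.ne_zero _)
    · exact ⟨1, one_ne_zero, fun t _ ht => absurd ⟨t, ht⟩ hB⟩
  choose D hD hD0 using hpoly
  have hne : E * ∏ B ∈ T, D B ≠ 0 := mul_ne_zero hE (Finset.prod_ne_zero_iff.2 fun B _ => hD B)
  obtain ⟨t, ht⟩ : ∃ t, MvPolynomial.eval t (E * ∏ B ∈ T, D B) ≠ 0 := by
    by_contra! h
    exact hne (MvPolynomial.funext fun t => by rw [h, map_zero])
  rw [map_mul, map_prod] at ht
  obtain ⟨B, hBT, hB⟩ := hcover t (left_ne_zero_of_mul ht)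
  exact right_ne_zero_of_mul ht
    (Finset.prod_eq_zero hBT (hD0 B t (left_ne_zero_of_mul ht) hB))
end

section
/- Let K be a field of characteristic different from 2, let N ≥ 1, and let A_1,…,A_N ∈ K^{N×N} be skew-symmetric matrices (A_iᵀ = −A_i). Then for every vector x ∈ Kᴺ, the N×N matrix whose j-th column is A_j x (for j = 1,…,N) is singular, i.e., has determinant zero. Consequently the subspace ℬ_A := {(A_1x | ⋯ | A_Nx) : x ∈ Kᴺ} of K^{N×N} consists entirely of singular matrices. -/
open Matrix

/-- The quadratic form of a skew-symmetric matrix vanishes when `2` is invertible. -/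
theorem dotProduct_mulVec_self_eq_zero_of_transpose_eq_neg {K n : Type*} [Field K] [Fintype n]
    (h2 : (2 : K) ≠ 0) {B : Matrix n n K} (hB : Bᵀ = -B) (x : n → K) :
    x ⬝ᵥ B *ᵥ x = 0 := by
  have h : x ⬝ᵥ B *ᵥ x = -(x ⬝ᵥ B *ᵥ x) := by
    conv_lhs => rw [dotProduct_mulVec, ← mulVec_transpose, hB, neg_mulVec, neg_dotProduct,
      dotProduct_comm]
  have h' : 2 * (x ⬝ᵥ B *ᵥ x) = 0 := by linear_combination h
  exact (mul_eq_zero.mp h').resolve_left h2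

/-- If `A₁, …, A_N` are skew-symmetric `N × N` matrices over a field of
characteristic different from 2, then for every `x ∈ Kᴺ` the matrix with columns
`A₁x, …, A_Nx` is singular; consequently every member of the space
`ℬ_A = {(A₁x | ⋯ | A_Nx) : x ∈ Kᴺ}` has determinant zero. -/
theorem skew_columns_singular (K : Type*) [Field K] (h2 : ringChar K ≠ 2)
    (N : ℕ) (hN : 1 ≤ N)
    (A : Fin N → Matrix (Fin N) (Fin N) K) (hA : ∀ j, (A j)ᵀ = -(A j)) :
    (∀ x : Fin N → K,
      (Matrix.of fun (i j : Fin N) => (A j).mulVec x i).det = 0) ∧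
    ∀ M : Matrix (Fin N) (Fin N) K,
      (∃ x : Fin N → K, M = Matrix.of fun (i j : Fin N) => (A j).mulVec x i) →
      M.det = 0 := by
  have hdet : ∀ x : Fin N → K,
      (Matrix.of fun (i j : Fin N) => (A j).mulVec x i).det = 0 := by
    intro x
    by_cases hx : x = 0
    · subst hx
      have : Nonempty (Fin N) := ⟨⟨0, hN⟩⟩
      simp only [mulVec_zero, Pi.zero_apply]
      exact det_zero
    · refine exists_vecMul_eq_zero_iff.mp ⟨x, hx, ?_⟩
      ext j
      exact dotProduct_mulVec_self_eq_zero_of_transpose_eq_neg (Ring.two_ne_zero h2) (hA j) x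
  refine ⟨hdet, ?_⟩
  rintro M ⟨x, rfl⟩
  exact hdet x
end

section
/- Let K be a field, n ≥ 1, and let V ⊆ K[x_1,…,x_n] be an m-dimensional subspace with a K-basis f_1,…,f_m such that f_1 = 1 and, for each i = 2,…,m, there exist affine-linear forms ℓ_{i1},…,ℓ_{i,i−1} ∈ F_1 with f_i = Σ_{j<i} ℓ_{ij} f_j. Let M_V be the (m−1)×m matrix over K[x_1,…,x_n] whose row indexed by i (for i = 2,…,m) equals (−ℓ_{i1}, −ℓ_{i2}, …, −ℓ_{i,i−1}, 1, 0, …, 0), with the entry 1 in column i. Then the K-linear span of the m maximal ((m−1)×(m−1)) subdeterminants of M_V (the determinants of the submatrices obtained by deleting one column) equals V. -/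
open MvPolynomial

/-- Cramer's rule for a vector in the kernel of an `m × (m + 1)` matrix. -/
theorem Matrix.det_submatrix_succAbove_mul_of_mulVec_eq_zero {R : Type*} [CommRing R] {m : ℕ}
    (M : Matrix (Fin m) (Fin (m + 1)) R) (v : Fin (m + 1) → R) (h : M.mulVec v = 0)
    (j : Fin (m + 1)) :
    (-1) ^ (j : ℕ) * (M.submatrix id j.succAbove).det * v 0 =
      (M.submatrix id Fin.succ).det * v j := by
  let N : Matrix (Fin (m + 1)) (Fin (m + 1)) R :=
    Matrix.of (Matrix.vecCons (Pi.single j 1) M)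
  have hsub (k : Fin (m + 1)) :
      N.submatrix Fin.succ k.succAbove = M.submatrix id k.succAbove := rfl
  have hdet : N.det = (-1) ^ (j : ℕ) * (M.submatrix id j.succAbove).det := by
    rw [Matrix.det_succ_row_zero, Finset.sum_eq_single j]
    · simp [hsub, N]
    · intro b _ hb
      simp [N, hb]
    · simp
  have hadj : N.adjugate 0 0 = (M.submatrix id Fin.succ).det := by
    have h0 := hsub 0
    simp only [Fin.succAbove_zero] at h0
    simp [Matrix.adjugate_fin_succ_eq_det_submatrix, h0]
  have hmul : N.mulVec v = Pi.single 0 (v j) := by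
    ext i
    refine Fin.cases ?_ (fun i => ?_) i
    · simp [N, Matrix.mulVec]
    · rw [Pi.single_eq_of_ne (Fin.succ_ne_zero i)]
      exact congrFun h i
  have key := congrFun (congrArg N.adjugate.mulVec hmul) 0
  rw [Matrix.mulVec_mulVec, Matrix.adjugate_mul] at key
  simpa [Matrix.smul_mulVec, hdet, hadj] using key

/-- Lemma 4.2. Let `V ⊆ K[x₁,…,xₙ]` be a subspace with basis
`f₀ = 1, f₁, …, f_m` such that each `f_{i}` (for `i ≥ 1`) equals `Σ_{j<i} ℓ_{ij} f_j` with
the `ℓ_{ij}` affine-linear. Let `M_V` be the `m × (m+1)` matrix whose row `i` is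
`(-ℓ_{i,0}, …, -ℓ_{i,i-1}, 1, 0, …, 0)` with the `1` in column `i`. Then the span of the
`m × m` subdeterminants of `M_V` (deleting one column) equals `V`. -/
theorem span_subdeterminants_eq (K : Type*) [Field K] (n m : ℕ)
    (V : Submodule K (MvPolynomial (Fin n) K))
    (f : Fin (m + 1) → MvPolynomial (Fin n) K)
    (hf_indep : LinearIndependent K f)
    (hf_span : Submodule.span K (Set.range f) = V)
    (hf0 : f 0 = 1)
    (l : Fin m → Fin (m + 1) → MvPolynomial (Fin n) K)
    (hl_aff : ∀ i j, l i j ∈ restrictTotalDegree (Fin n) K 1)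
    (hl_zero : ∀ (i : Fin m) (j : Fin (m + 1)), ¬ j < i.succ → l i j = 0)
    (hrel : ∀ i : Fin m, f i.succ = ∑ j : Fin (m + 1), l i j * f j) :
    Submodule.span K (Set.range fun j : Fin (m + 1) =>
      ((Matrix.of fun (i : Fin m) (j' : Fin (m + 1)) =>
          if j' = i.succ then 1 else -l i j').submatrix id j.succAbove).det) = V := by
  set M : Matrix (Fin m) (Fin (m + 1)) (MvPolynomial (Fin n) K) :=
    Matrix.of fun i j' => if j' = i.succ then 1 else -l i j' with hM
  have hker : M.mulVec f = 0 := by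
    ext1 i
    have hentry (j : Fin (m + 1)) :
        M i j * f j = (if j = i.succ then f j else 0) - l i j * f j := by
      by_cases hj : j = i.succ
      · simp [hM, hj, hl_zero i i.succ (lt_irrefl _)]
      · simp [hM, hj]
    simp [Matrix.mulVec, dotProduct, hentry, ← hrel]
  have hdet : (M.submatrix id Fin.succ).det = 1 := by
    rw [Matrix.det_of_isLowerTriangular]
    · simp [hM]
    · intro i j hij
      have hij' : i < j := hij
      simp [hM, hij'.ne', hl_zero i j.succ (by simpa using hij'.le)]
  have hminor (j : Fin (m + 1)) :
      (M.submatrix id j.succAbove).det = (-1 : K) ^ (j : ℕ) • f j := by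
    have h := Matrix.det_submatrix_succAbove_mul_of_mulVec_eq_zero M f hker j
    rw [hdet, hf0, one_mul, mul_one] at h
    rw [← h, MvPolynomial.smul_eq_C_mul, ← mul_assoc]
    simp [← mul_pow]
  simp only [hminor]
  rw [← hf_span]
  apply le_antisymm <;> rw [Submodule.span_le] <;> rintro _ ⟨j, rfl⟩
  · exact Submodule.smul_mem _ _ (Submodule.subset_span ⟨j, rfl⟩)
  · have h := Submodule.smul_mem _ ((-1 : K) ^ (j : ℕ)) (Submodule.subset_span
      (Set.mem_range_self (f := fun j : Fin (m + 1) => (-1 : K) ^ (j : ℕ) • f j) j))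
    simpa [smul_smul, ← mul_pow] using h
end

section
/- Let K be a field, n ≥ 1, d ≥ 0, and let V ⊆ K[x_1,…,x_n] be an m-dimensional subspace that is connected to 1 and satisfies F_1 · V ⊇ F_d. Then there exists a uniform determinantal representation of p_{n,d} of size m; in particular N*(n,d) ≤ m. -/
open MvPolynomial

/-- An element of `L * span (f '' s)` is a combination of the `f j` with coefficients in `L`. -/
theorem exists_sum_of_mem_mul_span {K A ι : Type*} [Field K] [CommRing A] [Algebra K A]
    (L : Submodule K A) (f : ι → A) (s : Finset ι) {p : A}
    (hp : p ∈ L * Submodule.span K (f '' s)) :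
    ∃ l : ι → A, (∀ j, l j ∈ L) ∧ p = ∑ j ∈ s, l j * f j := by
  classical
  induction hp using Submodule.mul_induction_on' with
  | mem_mul_mem a ha b hb =>
    obtain ⟨c, rfl⟩ := (Submodule.mem_span_image_finset_iff_exists_fun K).1 hb
    refine ⟨fun j => (if h : j ∈ s then c ⟨j, h⟩ else 0) • a, fun j => L.smul_mem _ ha, ?_⟩
    rw [← Finset.sum_coe_sort s]
    simp [Finset.mul_sum]
  | add x _ y _ hx hy =>
    obtain ⟨l, hl, rfl⟩ := hx
    obtain ⟨l', hl', rfl⟩ := hy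
    refine ⟨fun j => l j + l' j, fun j => L.add_mem (hl j) (hl' j), ?_⟩
    simp [add_mul, Finset.sum_add_distrib]

/-- Polynomials of total degree at most one are spanned by `1` and the variables. -/
theorem restrictTotalDegree_one_le_span (σ K : Type*) [Field K] :
    restrictTotalDegree σ K 1 ≤
      Submodule.span K ({1} ∪ Set.range (X : σ → MvPolynomial σ K)) := by
  intro p hp
  rw [mem_restrictTotalDegree] at hp
  rw [p.as_sum]
  refine Submodule.sum_mem _ fun a ha => ?_
  have hd : a.degree ≤ 1 := (le_totalDegree ha).trans hp
  have hmon : monomial a (coeff a p) = coeff a p • monomial a (1 : K) := by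
    simp [smul_monomial]
  rw [hmon]
  refine Submodule.smul_mem _ _ (Submodule.subset_span ?_)
  rcases Nat.le_one_iff_eq_zero_or_eq_one.1 hd with h | h
  · rw [Finsupp.degree_eq_zero_iff] at h
    subst h
    exact Or.inl rfl
  · obtain ⟨i, rfl⟩ := (Finsupp.sum_eq_one_iff a).1 h
    exact Or.inr ⟨i, rfl⟩

theorem rename_mem_span_allowedMonomials {K : Type*} [Field K] {n d : ℕ}
    {l : MvPolynomial (Fin n) K} (hl : l ∈ restrictTotalDegree (Fin n) K 1) :
    rename Sum.inl l ∈ Submodule.span K (allowedMonomials K n d) := by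
  refine Submodule.span_induction (p := fun x _ => rename Sum.inl x ∈
    Submodule.span K (allowedMonomials K n d)) ?_ (by simp) ?_ ?_
    (restrictTotalDegree_one_le_span _ _ hl)
  · rintro x (rfl | ⟨i, rfl⟩)
    · exact Submodule.subset_span (by simp [allowedMonomials])
    · exact Submodule.subset_span (by simp [allowedMonomials])
  · intro x y _ _ hx hy
    rw [map_add]
    exact Submodule.add_mem _ hx hy
  · intro a x _ hx
    rw [map_smul]
    exact Submodule.smul_mem _ _ hx

theorem X_mul_rename_mem_span_allowedMonomials {K : Type*} [Field K] {n d : ℕ} (α : ExpLE n d)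
    {l : MvPolynomial (Fin n) K} (hl : l ∈ restrictTotalDegree (Fin n) K 1) :
    X (Sum.inr α) * rename Sum.inl l ∈ Submodule.span K (allowedMonomials K n d) := by
  refine Submodule.span_induction (p := fun x _ => X (Sum.inr α) * rename Sum.inl x ∈
    Submodule.span K (allowedMonomials K n d)) ?_ (by simp) ?_ ?_
    (restrictTotalDegree_one_le_span _ _ hl)
  · rintro x (rfl | ⟨i, rfl⟩)
    · exact Submodule.subset_span (by simp [allowedMonomials])
    · refine Submodule.subset_span (Or.inr ⟨(α, i), ?_⟩)
      simp
  · intro x y _ _ hx hy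
    rw [map_add, mul_add]
    exact Submodule.add_mem _ hx hy
  · intro a x _ hx
    rw [map_smul, mul_smul_comm]
    exact Submodule.smul_mem _ _ hx

theorem genPoly_eq_sum_rename_monomial (K : Type*) [Field K] (n d : ℕ) :
    genPoly K n d = ∑ α : ExpLE n d, X (Sum.inr α) * rename Sum.inl (monomial α.1 (1 : K)) := by
  refine Finset.sum_congr rfl fun α _ => ?_
  rw [rename_monomial, monomial_eq, Finsupp.prod_mapDomain_index_inj Sum.inl_injective,
    Finsupp.prod_fintype _ _ (by simp)]
  simp

/-- If every proper subspace `W` of `V` containing `a` can be enlarged by a vector of `G W`, then `V`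
is spanned by `finrank V` vectors, the first being `a` and each further one lying in `G` of the span
of its predecessors. -/
theorem Submodule.exists_spanning_sequence_of_extend {K E : Type*} [Field K] [AddCommGroup E]
    [Module K E] {V : Submodule K E} [FiniteDimensional K V] {m : ℕ}
    (hm : Module.finrank K V = m + 1) {a : E} (ha : a ≠ 0) (haV : a ∈ V)
    (G : Submodule K E → Submodule K E) (haG : ∀ W, a ∈ W → a ∈ G W)
    (hG : ∀ W, a ∈ W → ¬ V ≤ W → ∃ v ∈ V, v ∈ G W ∧ v ∉ W) :
    ∃ f : ℕ → E, f 0 = a ∧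
      (∀ k, f (k + 1) ∈ G (Submodule.span K (f '' Finset.range (k + 1)))) ∧
      V ≤ Submodule.span K (f '' Finset.range (m + 1)) := by
  have step : ∀ W : Submodule K E, ∃ v, a ∈ W → v ∈ V ∧ v ∈ G W ∧ (v ∈ W → V ≤ W) := by
    intro W
    by_cases hVW : V ≤ W
    · exact ⟨a, fun h => ⟨haV, haG W h, fun _ => hVW⟩⟩
    by_cases h : a ∈ W
    · obtain ⟨v, hv, hv', hvW⟩ := hG W h hVW
      exact ⟨v, fun _ => ⟨hv, hv', fun h => absurd h hvW⟩⟩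
    · exact ⟨0, fun h' => absurd h' h⟩
  choose v hv using step
  obtain ⟨W, hW0, hWsucc⟩ : ∃ W : ℕ → Submodule K E,
      W 0 = Submodule.span K {a} ∧ ∀ k, W (k + 1) = W k ⊔ Submodule.span K {v (W k)} :=
    ⟨fun k => Nat.rec (Submodule.span K {a}) (fun _ U => U ⊔ Submodule.span K {v U}) k,
      rfl, fun _ => rfl⟩
  let f : ℕ → E := fun k => Nat.casesOn k a fun k => v (W k)
  have hfsucc (k : ℕ) : f (k + 1) = v (W k) := rfl
  have hWf (k : ℕ) : W k = Submodule.span K (f '' Finset.range (k + 1)) := by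
    induction k with
    | zero => simp [hW0, f]
    | succ k ih =>
      rw [hWsucc, Finset.range_add_one (n := k + 1), Finset.coe_insert, Set.image_insert_eq,
        Submodule.span_insert, ← ih, hfsucc, sup_comm]
  have haW (k : ℕ) : a ∈ W k := by
    rw [hWf]
    exact Submodule.subset_span ⟨0, by simp, rfl⟩
  have hWV (k : ℕ) : W k ≤ V := by
    induction k with
    | zero =>
      rw [hW0]
      exact (Submodule.span_singleton_le_iff_mem _ _).2 haV
    | succ k ih =>
      rw [hWsucc]
      exact sup_le ih ((Submodule.span_singleton_le_iff_mem _ _).2 (hv _ (haW k)).1)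
  have hrank (k : ℕ) : V ≤ W k ∨ k + 1 ≤ Module.finrank K (W k) := by
    induction k with
    | zero =>
      right
      rw [hW0, finrank_span_singleton ha]
    | succ k ih =>
      have hle : W k ≤ W (k + 1) := by
        rw [hWsucc]
        exact le_sup_left
      by_cases hk : V ≤ W k
      · exact Or.inl (hk.trans hle)
      right
      have : FiniteDimensional K (W (k + 1)) := Submodule.finiteDimensional_of_le (hWV (k + 1))
      refine Nat.succ_le_of_lt ((ih.resolve_left hk).trans_lt
        (Submodule.finrank_lt_finrank_of_lt (lt_of_le_of_ne hle fun he => hk ?_)))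
      refine (hv _ (haW k)).2.2 ?_
      refine he.ge ?_
      rw [hWsucc]
      exact Submodule.mem_sup_right (Submodule.mem_span_singleton_self _)
  refine ⟨f, rfl, fun k => ?_, ?_⟩
  · rw [← hWf]
    exact (hv _ (haW k)).2.1
  · rw [← hWf]
    rcases hrank m with h | h
    · exact h
    · exact (Submodule.eq_of_le_of_finrank_le (hWV m) (hm.trans_le h)).ge

namespace ConnectedToOne

variable {K : Type*} [Field K] {n : ℕ} {V : Submodule K (MvPolynomial (Fin n) K)}

theorem exists_mem_mul_notMem (hV : ConnectedToOne K n V)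
    {W : Submodule K (MvPolynomial (Fin n) K)} (hVW : ¬ V ≤ W)
    (h0 : V ⊓ restrictTotalDegree (Fin n) K 0 ≤ W) :
    ∃ v ∈ V, v ∈ restrictTotalDegree (Fin n) K 1 * W ∧ v ∉ W := by
  by_contra! H
  have key : ∀ e, V ⊓ restrictTotalDegree (Fin n) K e ≤ W := by
    intro e
    induction e with
    | zero => exact h0
    | succ e ih =>
      intro v hv
      exact H v hv.1 (mul_le_mul' le_rfl ih (hV.2 e hv))
  exact hVW fun v hv => key v.totalDegree ⟨hv, by simp [mem_restrictTotalDegree]⟩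

theorem one_mem (hV : ConnectedToOne K n V) : (1 : MvPolynomial (Fin n) K) ∈ V := by
  by_contra h1
  have h0 : V ⊓ restrictTotalDegree (Fin n) K 0 ≤ ⊥ := by
    rintro v ⟨hv, hv0⟩
    have hc := totalDegree_eq_zero_iff_eq_C.1
      (Nat.le_zero.1 ((mem_restrictTotalDegree _ _ _).1 hv0))
    rw [Submodule.mem_bot]
    by_contra hne
    have ha : coeff 0 v ≠ 0 := fun h => hne (by rw [hc, h, map_zero])
    refine h1 ?_
    have := V.smul_mem (coeff 0 v)⁻¹ hv
    rwa [hc, coeff_C, if_pos rfl, smul_eq_C_mul, ← map_mul, inv_mul_cancel₀ ha, map_one] at this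
  obtain ⟨v, -, hv, hvb⟩ := hV.exists_mem_mul_notMem (fun h => hV.1 (le_bot_iff.1 h)) h0
  exact hvb (by simpa using hv)

/-- A space connected to `1` is spanned by a sequence that starts at `1` and each of whose further
terms is a combination of the earlier ones with coefficients of degree at most one. -/
theorem exists_spanning_sequence (hV : ConnectedToOne K n V) [FiniteDimensional K V] {m : ℕ}
    (hm : Module.finrank K V = m + 1) :
    ∃ f : ℕ → MvPolynomial (Fin n) K, f 0 = 1 ∧
      (∀ k, f (k + 1) ∈ restrictTotalDegree (Fin n) K 1 *
        Submodule.span K (f '' Finset.range (k + 1))) ∧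
      V ≤ Submodule.span K (f '' Finset.range (m + 1)) := by
  refine Submodule.exists_spanning_sequence_of_extend hm one_ne_zero hV.one_mem
    (fun W => restrictTotalDegree (Fin n) K 1 * W) (fun W h1 => ?_) (fun W h1 hVW => ?_)
  · rw [← mul_one (1 : MvPolynomial (Fin n) K)]
    exact Submodule.mul_mem_mul (by simp [mem_restrictTotalDegree]) h1
  · refine hV.exists_mem_mul_notMem hVW ?_
    rintro v ⟨-, hv0⟩
    rw [totalDegree_eq_zero_iff_eq_C.1
      (Nat.le_zero.1 ((mem_restrictTotalDegree _ _ _).1 hv0)), ← mul_one (C _), ← smul_eq_C_mul]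
    exact W.smul_mem _ h1

end ConnectedToOne

/-- If `M *ᵥ f = (p, 0, …, 0)` with `f 0 = 1`, and deleting the first row and column of `M`
leaves a lower unitriangular matrix, then `det M = p`. -/
theorem Matrix.det_eq_of_mulVec_eq_single {A : Type*} [CommRing A] {m : ℕ}
    (M : Matrix (Fin (m + 1)) (Fin (m + 1)) A) (f : Fin (m + 1) → A) (p : A) (hf : f 0 = 1)
    (hM : M.mulVec f = Pi.single 0 p) (hdiag : ∀ i : Fin m, M i.succ i.succ = 1)
    (hupper : ∀ i j : Fin m, i < j → M i.succ j.succ = 0) : M.det = p := by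
  have hadj : M.adjugate 0 0 = 1 := by
    rw [Matrix.adjugate_fin_succ_eq_det_submatrix]
    have : (M.submatrix (Fin.succAbove 0) (Fin.succAbove 0)).det = 1 := by
      rw [Matrix.det_of_isLowerTriangular _ fun i j hij => ?_]
      · simp [hdiag]
      · simpa using hupper i j hij
    simpa using this
  have h := congrFun (congrArg M.adjugate.mulVec hM) 0
  rw [Matrix.mulVec_mulVec, Matrix.adjugate_mul, Matrix.smul_mulVec, Matrix.one_mulVec,
    Matrix.mulVec_single] at h
  simpa [hf, hadj] using h

/-- Proposition 4.3. If `V ⊆ K[x₁,…,xₙ]` is an `m`-dimensional subspace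
connected to 1 with `F₁ · V ⊇ F_d`, then there is a uniform determinantal representation of
`p_{n,d}` of size `m`; in particular `N*(n,d) ≤ m`. -/
theorem udr_from_connected_space (K : Type*) [Field K] (n d m : ℕ)
    (V : Submodule K (MvPolynomial (Fin n) K)) [FiniteDimensional K V]
    (hdim : Module.finrank K V = m)
    (hconn : ConnectedToOne K n V)
    (hFV : restrictTotalDegree (Fin n) K d ≤ restrictTotalDegree (Fin n) K 1 * V) :
    (∃ M : Matrix (Fin m) (Fin m) (URing K n d), IsUDR K n d m M) ∧
      Nstar K n d ≤ m := by
  have hex : ∃ M : Matrix (Fin m) (Fin m) (URing K n d), IsUDR K n d m M := by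
    obtain ⟨m, rfl⟩ : ∃ k, m = k + 1 := by
      refine Nat.exists_eq_succ_of_ne_zero fun h => hconn.1 ?_
      rwa [← Submodule.finrank_eq_zero (R := K), hdim]
    obtain ⟨f, hf0, hfsucc, hVf⟩ := hconn.exists_spanning_sequence hdim
    choose l hl hfl using fun k => exists_sum_of_mem_mul_span _ _ _ (hfsucc k)
    have hmon (α : ExpLE n d) : monomial α.1 (1 : K) ∈ restrictTotalDegree (Fin n) K 1 *
        Submodule.span K (f '' Finset.range (m + 1)) :=
      mul_le_mul' le_rfl hVf (hFV ((mem_restrictTotalDegree _ _ _).2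
        ((totalDegree_monomial_le _ _).trans α.2)))
    choose g hg hgf using fun α => exists_sum_of_mem_mul_span _ _ _ (hmon α)
    let M : Matrix (Fin (m + 1)) (Fin (m + 1)) (URing K n d) :=
      Fin.cons (fun j => ∑ α, X (Sum.inr α) * rename Sum.inl (g α j))
        fun i j => rename Sum.inl
          ((if j = i.succ then 1 else 0) - if j < i.succ then l i j else 0)
    refine ⟨M, fun i j => ?_, ?_⟩
    · refine Fin.cases ?_ (fun i => ?_) i
      · exact Submodule.sum_mem _ fun α _ => X_mul_rename_mem_span_allowedMonomials α (hg α j)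
      · refine rename_mem_span_allowedMonomials (Submodule.sub_mem _ ?_ ?_)
        · split_ifs
          · simp [mem_restrictTotalDegree]
          · exact Submodule.zero_mem _
        · split_ifs
          · exact hl i j
          · exact Submodule.zero_mem _
    · refine M.det_eq_of_mulVec_eq_single (fun j => rename Sum.inl (f j)) _ (by simp [hf0])
        (funext fun i => ?_) (fun i => ?_) (fun i j hij => ?_)
      · refine Fin.cases ?_ (fun i => ?_) i
        · simp only [Matrix.mulVec, dotProduct, M, Fin.cons_zero, Pi.single_eq_same,
            genPoly_eq_sum_rename_monomial, Finset.sum_mul]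
          rw [Finset.sum_comm]
          refine Finset.sum_congr rfl fun α _ => ?_
          rw [hgf α, Finset.sum_range, map_sum, Finset.mul_sum]
          simp [mul_assoc]
        · simp only [Matrix.mulVec, dotProduct, M, Fin.cons_succ, ← map_mul, ← map_sum]
          rw [Pi.single_eq_of_ne (Fin.succ_ne_zero i)]
          convert map_zero (rename Sum.inl)
          simp only [sub_mul, Finset.sum_sub_distrib, ite_mul, one_mul, zero_mul,
            Finset.sum_ite_eq', Finset.mem_univ, if_true, Fin.val_succ, Fin.lt_def]
          rw [hfl i, sub_eq_zero,
            ← Finset.sum_range (fun j => if j < (i : ℕ) + 1 then l i j * f j else 0),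
            ← Finset.sum_filter]
          refine Finset.sum_congr ?_ fun _ _ => rfl
          ext j
          simp only [Finset.mem_filter, Finset.mem_range]
          omega
      · simp [M]
      · have h1 : j ≠ i := hij.ne'
        simp [M, h1, hij.le.not_gt]
  exact ⟨hex, Nat.sInf_le hex⟩
end
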